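/- arXiv:2509.08517 — 3 statements merged into one kernel-verified Lean document; each statement's English description precedes it below -/
import Mathlib

section
/- Fix λ ∈ ℂ with λ ≠ 0, let R = P/Q be a non-constant rational function of degree d = max(deg P, deg Q) (P, Q ∈ ℂ[X] coprime, Q ≠ 0, d ≥ 1), and let b ∈ ℂ with b ≠ 0. Suppose R and ∂_z R share the value 0 CM in ℂ* (equivalently, 0 is omitted by both R and ∂_z R in ℂ*) and share the value b in ℂ*. Then either P·Q = λ·X·(P'·Q − P·Q') in ℂ[X] (i.e., R ≡ ∂_z R), or there exists C ∈ ℂ∖{0} such that λ = −2/d and for every w ∈ ℂ∖{0} with Q(w) ≠ 0 and 1 + C·w^d ≠ 0 one has P(w)/Q(w) = 2b/(1 + C·w^d), or there exists C ∈ ℂ∖{0} such that λ = 2/d and for every w ∈ ℂ∖{0} with Q(w) ≠ 0 and w^d + C ≠ 0 one has P(w)/Q(w) = 2b·w^d/(w^d + C). -/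
open Polynomial

open UniqueFactorizationMonoid

theorem eq_C_mul_X_pow_of_eval_ne_zero {p : ℂ[X]}
    (h : ∀ w : ℂ, w ≠ 0 → p.eval w ≠ 0) :
    p = C p.leadingCoeff * X ^ p.natDegree := by
  have hs := IsAlgClosed.splits p
  have hr : p.roots = Multiset.replicate p.natDegree 0 := by
    rw [Multiset.eq_replicate]
    refine ⟨hs.natDegree_eq_card_roots.symm, fun w hw => ?_⟩
    by_contra hw0
    exact h w hw0 (isRoot_of_mem_roots hw)
  conv_lhs => rw [hs.eq_prod_roots, hr]
  simp

theorem radical_dvd_of_eval_eq_zero {F H : ℂ[X]} (hH : H ≠ 0)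
    (h : ∀ w, F.eval w = 0 → H.eval w = 0) : radical F ∣ H := by
  have hs : (radical F).Separable := PerfectField.separable_iff_squarefree.2 squarefree_radical
  rw [(IsAlgClosed.splits (radical F)).dvd_iff_roots_le_roots radical_ne_zero hH,
    Multiset.le_iff_subset (nodup_roots hs)]
  intro w hw
  rw [mem_roots hH]
  exact h w (eval_eq_zero_of_dvd_of_eval_eq_zero radical_dvd_self (isRoot_of_mem_roots hw))

theorem eval_radical_eq_zero_iff {Q : ℂ[X]} (hQ : Q ≠ 0) (w : ℂ) :
    (radical Q).eval w = 0 ↔ Q.eval w = 0 := by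
  rw [← IsRoot.def, ← IsRoot.def, ← dvd_iff_isRoot, ← dvd_iff_isRoot]
  exact dvd_radical_iff_of_irreducible (irreducible_X_sub_C w) hQ

theorem derivative_ne_zero_of_eval_eq_zero {P : ℂ[X]} (hP : P ≠ 0) {a : ℂ}
    (ha : P.eval a = 0) : derivative P ≠ 0 := by
  intro h0
  obtain ⟨x, rfl⟩ := natDegree_eq_zero.1 (derivative_eq_zero.1 h0)
  rw [eval_C] at ha
  exact hP (by rw [ha, C_0])

/-- If `Q = g * radical Q` and `Q' = g * r`, then `r` does not vanish at the roots of `Q`. -/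
theorem eval_ne_zero_of_derivative_eq {Q g r : ℂ[X]} (hQ : Q ≠ 0)
    (hg : Q = g * radical Q) (hr : derivative Q = g * r) {a : ℂ} (ha : Q.eval a = 0) :
    r.eval a ≠ 0 := by
  intro hra
  have hD := derivative_ne_zero_of_eval_eq_zero hQ ha
  have h1 := derivative_rootMultiplicity_of_root (p := Q) ha
  have hgq : g * radical Q ≠ 0 := hg ▸ hQ
  have hgr : g * r ≠ 0 := hr ▸ hD
  have h2 := congrArg (rootMultiplicity a) hg
  have h3 := congrArg (rootMultiplicity a) hr
  rw [rootMultiplicity_mul hgq] at h2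
  rw [rootMultiplicity_mul hgr] at h3
  have hs : (radical Q).Separable := PerfectField.separable_iff_squarefree.2 squarefree_radical
  have h4 := rootMultiplicity_le_one_of_separable hs a
  have h5 := (rootMultiplicity_pos (right_ne_zero_of_mul hgr)).2 hra
  have h6 := (rootMultiplicity_pos hQ).2 ha
  omega

theorem natDegree_le_radical_add_radical {A : ℂ[X]} (hA0 : A.eval 0 ≠ 0)
    (hA : A.natDegree ≠ 0) {e : ℂ} (he : e ≠ 0) {n : ℕ} (hn : n ≠ 0) :
    A.natDegree ≤ (radical A).natDegree + (radical (A + C e * X ^ n)).natDegree := by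
  have hA1 : A ≠ 0 := by rintro rfl; simp at hA0
  have hB : C e * X ^ n ≠ 0 := by simp [he]
  have hAX : IsCoprime A (C e * X ^ n) := by
    refine (isCoprime_mul_unit_left_right (isUnit_C.2 he.isUnit) _ _).2 (IsCoprime.pow_right ?_)
    refine (irreducible_X.coprime_iff_not_dvd.2 ?_).symm
    rwa [X_dvd_iff, coeff_zero_eq_eval_zero]
  have hF : A + C e * X ^ n ≠ 0 := by
    intro h
    have := congrArg (eval 0) h
    simp [hn, hA0] at this
  have hradX : (radical (C e * X ^ n)).natDegree ≤ 1 := by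
    rw [radical_mul_of_isUnit_left (isUnit_C.2 he.isUnit), radical_pow_of_prime prime_X hn,
      monic_X.normalize_eq_self, natDegree_X]
  rcases Polynomial.abc hA1 hB (neg_ne_zero.2 hF) hAX (by ring) with h | h
  · have h1 := h.1
    have h2 : (radical (A * (C e * X ^ n) * -(A + C e * X ^ n))).natDegree ≤
        (radical A).natDegree + (radical (C e * X ^ n)).natDegree +
          (radical (A + C e * X ^ n)).natDegree := by
      have hd := radical_mul_dvd (a := A * (C e * X ^ n)) (b := -(A + C e * X ^ n))
      rw [UniqueFactorizationDomain.radical_neg] at hd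
      have hd' := hd.trans (mul_dvd_mul_right (radical_mul_dvd (a := A) (b := C e * X ^ n)) _)
      refine (natDegree_le_of_dvd hd' (by simp)).trans ?_
      rw [natDegree_mul (by simp) (by simp), natDegree_mul (by simp) (by simp)]
    omega
  · exact absurd (derivative_eq_zero.1 h.1) hA

/-- If all solutions `u` of `(α u + β)² = e u` coincide, then `u = β / α` is a double root. -/
theorem eq_four_mul_of_subsingleton {α β e : ℂ} (hα : α ≠ 0) (he : e ≠ 0)
    (h : ∀ u v : ℂ, (α * u + β) ^ 2 = e * u → (α * v + β) ^ 2 = e * v → u = v) :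
    e = 4 * α * β := by
  obtain ⟨s, hs⟩ := IsAlgClosed.exists_pow_nat_eq (e * (e - 4 * α * β)) two_pos
  have hu : ((e - 2 * α * β) + s) / (2 * α ^ 2) = ((e - 2 * α * β) - s) / (2 * α ^ 2) := by
    apply h
    · field_simp
      linear_combination hs
    · field_simp
      linear_combination hs
  have h0 : s = 0 := by
    field_simp at hu
    linear_combination hu / 2
  rw [h0, zero_pow two_ne_zero, eq_comm, mul_eq_zero] at hs
  exact sub_eq_zero.1 (hs.resolve_left he)

theorem eval_ne_zero_of_rootMultiplicity_eq {l : ℂ} (hl : l ≠ 0) {P Q : ℂ[X]} (hP : P ≠ 0)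
    {w : ℂ} (hw : w ≠ 0) (hQw : Q.eval w ≠ 0)
    (h : rootMultiplicity w P =
      rootMultiplicity w (C l * X * (derivative P * Q - P * derivative Q))) :
    P.eval w ≠ 0 := by
  intro hPw
  have hcop : ∀ A : ℂ[X], A.eval w ≠ 0 → IsCoprime ((X - C w) ^ rootMultiplicity w P) A := by
    intro A hA
    refine IsCoprime.pow_left ((irreducible_X_sub_C w).coprime_iff_not_dvd.2 ?_)
    rwa [dvd_iff_isRoot]
  have h1 := pow_rootMultiplicity_dvd (C l * X * (derivative P * Q - P * derivative Q)) w
  rw [← h] at h1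
  have h2 := (hcop (C l * X) (by simp [hl, hw])).dvd_of_dvd_mul_left h1
  have h3 := (dvd_sub_left ((pow_rootMultiplicity_dvd P w).mul_right _)).1 h2
  have h4 := (hcop Q hQw).dvd_of_dvd_mul_right h3
  have hD := derivative_ne_zero_of_eval_eq_zero hP hPw
  have h5 := (le_rootMultiplicity_iff hD).2 h4
  rw [derivative_rootMultiplicity_of_root hPw] at h5
  have h6 := (rootMultiplicity_pos hP).2 hPw
  omega

theorem X_mul_derivative_C_mul_X_pow (c : ℂ) (m : ℕ) :
    X * derivative (C c * X ^ m) = C (m : ℂ) * (C c * X ^ m) := by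
  rcases m with _ | m
  · simp
  · simp only [derivative_C_mul, derivative_X_pow, Nat.add_sub_cancel]
    ring

theorem mul_eq_of_monomials {l b c κ : ℂ} {m k : ℕ} (hb : b ≠ 0) (hc : c ≠ 0) (hκ : κ ≠ 0)
    (hmk : m = 0 ∧ k ≠ 0 ∨ k = 0 ∧ m ≠ 0) {P Q : ℂ[X]} (hP : P = C c * X ^ m)
    (hQ : Q = C κ * X ^ k)
    (hshareb : ∀ w : ℂ, w ≠ 0 → Q.eval w ≠ 0 → P.eval w = b * Q.eval w →
      l * w * (derivative P * Q - P * derivative Q).eval w = b * (Q.eval w) ^ 2) :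
    P * Q = C l * X * (derivative P * Q - P * derivative Q) := by
  have hPX : X * derivative P = C (m : ℂ) * P := hP ▸ X_mul_derivative_C_mul_X_pow c m
  have hQX : X * derivative Q = C (k : ℂ) * Q := hQ ▸ X_mul_derivative_C_mul_X_pow κ k
  have key : X * (derivative P * Q - P * derivative Q) = C ((m : ℂ) - k) * (P * Q) := by
    rw [C_sub]
    linear_combination Q * hPX - P * hQX
  obtain ⟨w, hw, hPw⟩ : ∃ w : ℂ, w ≠ 0 ∧ P.eval w = b * Q.eval w := by
    rcases hmk with ⟨rfl, hk⟩ | ⟨rfl, hm⟩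
    · obtain ⟨w, hw⟩ := IsAlgClosed.exists_pow_nat_eq (c / (b * κ)) (Nat.pos_of_ne_zero hk)
      refine ⟨w, ?_, ?_⟩
      · rintro rfl
        rw [zero_pow hk, eq_comm, div_eq_zero_iff] at hw
        simp_all
      · simp only [hP, hQ, eval_mul, eval_C, eval_pow, eval_X, hw]
        field_simp
    · obtain ⟨w, hw⟩ := IsAlgClosed.exists_pow_nat_eq (b * κ / c) (Nat.pos_of_ne_zero hm)
      refine ⟨w, ?_, ?_⟩
      · rintro rfl
        rw [zero_pow hm, eq_comm, div_eq_zero_iff] at hw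
        simp_all
      · simp only [hP, hQ, eval_mul, eval_C, eval_pow, eval_X, hw]
        field_simp
  have hQw : Q.eval w ≠ 0 := by simp [hQ, hκ, hw]
  have h1 := hshareb w hw hQw hPw
  have h2 := congrArg (eval w) key
  rw [eval_mul, eval_X] at h2
  have h3 : l * ((m : ℂ) - k) = 1 := by
    have : b * eval w Q ^ 2 * (l * ((m : ℂ) - k)) = b * eval w Q ^ 2 * 1 := by
      rw [eval_mul, eval_C, eval_mul, hPw] at h2
      linear_combination h1 - l * h2
    exact mul_left_cancel₀ (by simp [hb, hQw]) this
  rw [mul_assoc, key, ← mul_assoc, ← C_mul, h3, C_1, one_mul]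

theorem natDegree_le_natDegree_radical_of_share {l b c t : ℂ} {m j : ℕ} (hl : l ≠ 0)
    (hb : b ≠ 0) (hc : c ≠ 0) (ht : t ≠ 0) {Q g : ℂ[X]} (hQ0 : Q.eval 0 ≠ 0)
    (hg : Q = g * radical Q) (hq : (radical Q).natDegree ≠ 0)
    (hj : j ≤ (radical Q).natDegree) (hmj : m + j ≠ 0)
    (hH : C (l * t) * X ^ j - radical Q ≠ 0)
    (hshare : ∀ w : ℂ, w ≠ 0 → Q.eval w ≠ 0 →
      l * (c * w ^ m * (g.eval w * (t * w ^ j))) = b * Q.eval w ^ 2 →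
      c * w ^ m = b * Q.eval w) :
    Q.natDegree ≤ (radical Q).natDegree := by
  have hQ : Q ≠ 0 := by rintro rfl; simp at hQ0
  have hq0 : (radical Q).eval 0 ≠ 0 := by rwa [Ne, eval_radical_eq_zero_iff hQ]
  have hA : (C b * (Q * radical Q)).natDegree = Q.natDegree + (radical Q).natDegree := by
    rw [natDegree_C_mul hb, natDegree_mul hQ radical_ne_zero]
  have h1 := natDegree_le_radical_add_radical (A := C b * (Q * radical Q))
    (by simp [hb, hQ0, hq0]) (by omega) (e := -(l * c * t)) (by simp [hl, hc, ht]) hmj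
  have h2 : radical (C b * (Q * radical Q)) ∣ radical Q := by
    refine radical_dvd_of_eval_eq_zero radical_ne_zero fun w hw => ?_
    simpa [hb, eval_radical_eq_zero_iff hQ] using hw
  have h3 : radical (C b * (Q * radical Q) + C (-(l * c * t)) * X ^ (m + j)) ∣
      C (l * t) * X ^ j - radical Q := by
    refine radical_dvd_of_eval_eq_zero hH fun w hw => ?_
    simp only [eval_add, eval_mul, eval_C, eval_pow, eval_X] at hw
    have hw0 : w ≠ 0 := by
      rintro rfl
      rw [zero_pow hmj] at hw
      simp [hb, hQ0, hq0] at hw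
    have hQw : Q.eval w ≠ 0 := by
      intro h
      simp [h, hl, hc, ht, hw0] at hw
    have hgw : Q.eval w = g.eval w * (radical Q).eval w := by
      conv_lhs => rw [hg, eval_mul]
    have h4 := hshare w hw0 hQw (by
      rw [pow_add] at hw
      linear_combination -g.eval w * hw - b * Q.eval w * hgw)
    simp only [eval_sub, eval_mul, eval_C, eval_pow, eval_X]
    apply mul_left_cancel₀ (mul_ne_zero hb hQw)
    rw [pow_add] at hw
    linear_combination -hw - l * t * w ^ j * h4
  have h4 := natDegree_le_of_dvd h2 radical_ne_zero
  have h5 := natDegree_le_of_dvd h3 hH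
  have h6 : (C (l * t) * X ^ j - radical Q).natDegree ≤ (radical Q).natDegree :=
    (natDegree_sub_le _ _).trans (max_le ((natDegree_C_mul_X_pow_le _ _).trans hj) le_rfl)
  omega

/-- The normal form when `R = c / (α X ^ d + β)`. -/
theorem normal_form_of_const_num {l b c α β : ℂ} {d : ℕ} (hd : d ≠ 0) (hl : l ≠ 0)
    (hb : b ≠ 0) (hc : c ≠ 0) (hα : α ≠ 0) (hβ : β ≠ 0)
    (h : ∀ w : ℂ, w ≠ 0 → α * w ^ d + β ≠ 0 →
      l * (c * -(d * (α * w ^ d))) = b * (α * w ^ d + β) ^ 2 → c = b * (α * w ^ d + β)) :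
    c = 2 * b * β ∧ l = -2 / d := by
  have hd' : (d : ℂ) ≠ 0 := Nat.cast_ne_zero.2 hd
  have h1 : ∀ u : ℂ, (α * u + β) ^ 2 = -(l * c * d * α / b) * u → c = b * (α * u + β) := by
    intro u hu
    obtain ⟨w, rfl⟩ := IsAlgClosed.exists_pow_nat_eq u (Nat.pos_of_ne_zero hd)
    have hw : w ≠ 0 := by
      rintro rfl
      simp [hd, hβ] at hu
    refine h w hw (fun h0 => ?_) ?_
    · rw [h0] at hu
      simp [hl, hc, hα, hb, hw, hd] at hu
    · rw [hu]
      field_simp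
  have h2 := eq_four_mul_of_subsingleton (β := β) hα
    (by simp [hl, hc, hα, hb, hd] : -(l * c * d * α / b) ≠ 0) fun u v hu hv => by
      have h3 : b * (α * u + β) = b * (α * v + β) := (h1 u hu).symm.trans (h1 v hv)
      exact mul_left_cancel₀ hα (add_right_cancel (mul_left_cancel₀ hb h3))
  have h3 : c = 2 * b * β := by
    rw [h1 (β / α) (by rw [h2]; field_simp; ring)]
    field_simp
    ring
  refine ⟨h3, ?_⟩
  rw [h3] at h2
  field_simp at h2 ⊢
  linear_combination -h2 / 2

/-- The normal form when `R = c X ^ d / (α X ^ d + β)`. -/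
theorem normal_form_of_pow_num {l b c α β : ℂ} {d : ℕ} (hd : d ≠ 0) (hl : l ≠ 0)
    (hb : b ≠ 0) (hc : c ≠ 0) (hα : α ≠ 0) (hβ : β ≠ 0)
    (h : ∀ w : ℂ, w ≠ 0 → α * w ^ d + β ≠ 0 →
      l * (c * w ^ d * (d * β)) = b * (α * w ^ d + β) ^ 2 →
        c * w ^ d = b * (α * w ^ d + β)) :
    c = 2 * b * α ∧ l = 2 / d := by
  have hd' : (d : ℂ) ≠ 0 := Nat.cast_ne_zero.2 hd
  have h1 : ∀ u : ℂ, (α * u + β) ^ 2 = (l * c * d * β / b) * u → c * u = b * (α * u + β) := by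
    intro u hu
    obtain ⟨w, rfl⟩ := IsAlgClosed.exists_pow_nat_eq u (Nat.pos_of_ne_zero hd)
    have hw : w ≠ 0 := by
      rintro rfl
      simp [hd, hβ] at hu
    refine h w hw (fun h0 => ?_) ?_
    · rw [h0] at hu
      simp [hl, hc, hβ, hb, hw, hd] at hu
    · rw [hu]
      field_simp
  have h2 := eq_four_mul_of_subsingleton (β := β) hα
    (by simp [hl, hc, hβ, hb, hd] : l * c * d * β / b ≠ 0) fun u v hu hv => by
      have hu' := h1 u hu
      have hv' := h1 v hv
      have h3 : c - b * α ≠ 0 := by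
        intro h0
        have : b * β = 0 := by linear_combination u * h0 - hu'
        simp [hb, hβ] at this
      apply mul_left_cancel₀ h3
      linear_combination hu' - hv'
  have h3 : c = 2 * b * α := by
    have h4 := h1 (β / α) (by rw [h2]; field_simp; ring)
    field_simp at h4
    linear_combination h4
  refine ⟨h3, ?_⟩
  rw [h3] at h2
  field_simp at h2 ⊢
  linear_combination h2 / 2

theorem eq_C_mul_X_pow_add_C_of_coeff {Q : ℂ[X]} (hd : Q.natDegree ≠ 0)
    (h : ∀ n, n ≠ 0 → n ≠ Q.natDegree → Q.coeff n = 0) :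
    Q = C Q.leadingCoeff * X ^ Q.natDegree + C (Q.eval 0) := by
  ext n
  rw [coeff_add, coeff_C_mul_X_pow, coeff_C, ← coeff_zero_eq_eval_zero]
  split_ifs with h1 h2 h2
  · omega
  · simp [h1]
  · simp [h2]
  · simp [h n h2 h1]

/-- If a non-constant rational function `R = P/Q` of degree `d` and `∂_z R` share the
value `0` CM in `ℂ*` and share a finite value `b ≠ 0` in `ℂ*`, then `R ≡ ∂_z R`, or
`R(w) = 2b/(1 + C·w^d)` with `λ = −2/d`, or `R(w) = 2b·w^d/(w^d + C)` with `λ = 2/d`. -/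
theorem R_dzR_share_zeroCM_bIM_in_Cstar
    (l : ℂ) (hl : l ≠ 0)
    (P Q : ℂ[X]) (hPQ : IsCoprime P Q) (hQ : Q ≠ 0)
    (d : ℕ) (hd : d = max P.natDegree Q.natDegree) (hd1 : 1 ≤ d)
    (b : ℂ) (hb : b ≠ 0)
    (hshare0 : ∀ w : ℂ, w ≠ 0 → Q.eval w ≠ 0 →
      (P.eval w = 0 ↔ l * w * (derivative P * Q - P * derivative Q).eval w = 0))
    (hCM : ∀ w : ℂ, w ≠ 0 → Q.eval w ≠ 0 →
      rootMultiplicity w P =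
        rootMultiplicity w (C l * X * (derivative P * Q - P * derivative Q)))
    (hshareb : ∀ w : ℂ, w ≠ 0 → Q.eval w ≠ 0 →
      (P.eval w = b * Q.eval w ↔
        l * w * (derivative P * Q - P * derivative Q).eval w = b * (Q.eval w) ^ 2)) :
    P * Q = C l * X * (derivative P * Q - P * derivative Q) ∨
    (∃ C₀ : ℂ, C₀ ≠ 0 ∧ l = -2 / d ∧
      ∀ w : ℂ, w ≠ 0 → Q.eval w ≠ 0 → 1 + C₀ * w ^ d ≠ 0 →
        P.eval w / Q.eval w = 2 * b / (1 + C₀ * w ^ d)) ∨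
    (∃ C₀ : ℂ, C₀ ≠ 0 ∧ l = 2 / d ∧
      ∀ w : ℂ, w ≠ 0 → Q.eval w ≠ 0 → w ^ d + C₀ ≠ 0 →
        P.eval w / Q.eval w = 2 * b * w ^ d / (w ^ d + C₀)) := by
  have no_common : ∀ w, P.eval w = 0 → Q.eval w ≠ 0 := by
    obtain ⟨u, v, huv⟩ := hPQ
    intro w hP hQ
    simpa [hP, hQ] using congrArg (eval w) huv
  have hP : P ≠ 0 := by
    rintro rfl
    have := natDegree_eq_zero_of_isUnit (isCoprime_zero_left.1 hPQ)
    simp_all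
  have hPw : ∀ w : ℂ, w ≠ 0 → P.eval w ≠ 0 := fun w hw h =>
    eval_ne_zero_of_rootMultiplicity_eq hl hP hw (no_common w h) (hCM w hw (no_common w h)) h
  obtain ⟨c, m, hc, hPc⟩ : ∃ (c : ℂ) (m : ℕ), c ≠ 0 ∧ P = C c * X ^ m :=
    ⟨_, _, leadingCoeff_ne_zero.2 hP, eq_C_mul_X_pow_of_eval_ne_zero hPw⟩
  have hPdeg : P.natDegree = m := by rw [hPc, natDegree_C_mul_X_pow m c hc]
  have hm0 : Q.eval 0 = 0 → m = 0 := by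
    intro h
    by_contra hm
    exact no_common 0 (by simp [hPc, hm]) h
  by_cases hQ' : ∀ w : ℂ, w ≠ 0 → Q.eval w ≠ 0
  · left
    have hQk := eq_C_mul_X_pow_of_eval_ne_zero hQ'
    refine mul_eq_of_monomials hb hc (leadingCoeff_ne_zero.2 hQ) ?_ hPc hQk
      fun w hw hQw => (hshareb w hw hQw).1
    by_cases hk : Q.natDegree = 0
    · exact Or.inr ⟨hk, by omega⟩
    · exact Or.inl ⟨hm0 (by rw [hQk]; simp [hk]), hk⟩
  right
  push Not at hQ'
  obtain ⟨a, ha0, ha⟩ := hQ'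
  obtain ⟨g, hg⟩ : ∃ g, Q = g * radical Q := ⟨_, EuclideanDomain.divRadical_mul_radical.symm⟩
  obtain ⟨r, hr⟩ : g ∣ derivative Q := by
    rw [EuclideanDomain.eq_divRadical ((mul_comm _ _).trans hg.symm)]
    exact divRadical_dvd_derivative Q
  have hqw : ∀ w, (radical Q).eval w = 0 ↔ Q.eval w = 0 := eval_radical_eq_zero_iff hQ
  have hrw : ∀ w, Q.eval w = 0 → r.eval w ≠ 0 := fun w => eval_ne_zero_of_derivative_eq hQ hg hr
  have hg0 : g ≠ 0 := left_ne_zero_of_mul (hg ▸ hQ)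
  have hr0 : r ≠ 0 := by
    rintro rfl
    simpa using hrw a ha
  have hQd : Q.natDegree = g.natDegree + (radical Q).natDegree := by
    conv_lhs => rw [hg, natDegree_mul hg0 radical_ne_zero]
  have hQd0 : Q.natDegree ≠ 0 := by
    intro h
    obtain ⟨x, rfl⟩ := natDegree_eq_zero.1 h
    rw [eval_C] at ha
    simp [ha] at hQ
  have hqd0 : (radical Q).natDegree ≠ 0 := by
    intro h
    obtain ⟨x, hx⟩ := natDegree_eq_zero.1 h
    have h1 := (hqw a).2 ha
    rw [← hx, eval_C] at h1
    exact radical_ne_zero (a := Q) (by rw [← hx, h1, C_0])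
  have hrd : r.natDegree + 1 = (radical Q).natDegree := by
    have h1 := natDegree_derivative Q
    rw [hr, natDegree_mul hg0 hr0] at h1
    omega
  have hr_lead : r.leadingCoeff = Q.natDegree * (radical Q).leadingCoeff := by
    have h1 := congrArg leadingCoeff hr
    have h2 := congrArg leadingCoeff hg
    rw [leadingCoeff_mul] at h1 h2
    rw [leadingCoeff_derivative, h2] at h1
    apply mul_left_cancel₀ (leadingCoeff_ne_zero.2 hg0)
    linear_combination -h1
  set T := C (m : ℂ) * radical Q - X * r with hTdef
  have hgT : C (m : ℂ) * Q - X * derivative Q = g * T := by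
    rw [hr, hTdef]
    linear_combination C (m : ℂ) * hg
  have key : ∀ w, w * (derivative P * Q - P * derivative Q).eval w =
      c * w ^ m * (g.eval w * T.eval w) := by
    intro w
    have h1 : X * derivative P = C (m : ℂ) * P := hPc ▸ X_mul_derivative_C_mul_X_pow c m
    have h2 : X * (derivative P * Q - P * derivative Q) = C c * X ^ m * (g * T) := by
      rw [← hgT, ← hPc]
      linear_combination Q * h1
    simpa using congrArg (eval w) h2
  have hTw : ∀ w : ℂ, w ≠ 0 → T.eval w ≠ 0 := by
    intro w hw hT
    by_cases hQw : Q.eval w = 0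
    · have h1 := hrw w hQw
      simp [hTdef, (hqw w).2 hQw, hw, h1] at hT
    · exact hPw w hw ((hshare0 w hw hQw).2 (by rw [mul_assoc, key, hT]; simp))
  have hT0 : T ≠ 0 := fun h => hTw 1 one_ne_zero (by rw [h, eval_zero])
  obtain ⟨t, j, ht, hTj⟩ : ∃ (t : ℂ) (j : ℕ), t ≠ 0 ∧ T = C t * X ^ j :=
    ⟨_, _, leadingCoeff_ne_zero.2 hT0, eq_C_mul_X_pow_of_eval_ne_zero hTw⟩
  have hTdeg : T.natDegree = j := by rw [hTj, natDegree_C_mul_X_pow j t ht]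
  have hT_le : j ≤ (radical Q).natDegree := by
    rw [← hTdeg]
    refine (natDegree_sub_le _ _).trans (max_le (natDegree_C_mul_le _ _) ?_)
    rw [natDegree_X_mul hr0, hrd]
  have hT_lead : T.coeff (radical Q).natDegree =
      ((m : ℂ) - Q.natDegree) * (radical Q).leadingCoeff := by
    rw [hTdef, coeff_sub, coeff_C_mul, ← hrd, coeff_X_mul, hrd]
    change _ - r.leadingCoeff = _
    rw [hr_lead, leadingCoeff]
    ring
  have hQ0 : Q.eval 0 ≠ 0 := by
    intro h0
    have hm := hm0 h0
    subst hm
    have hj : j ≠ 0 := by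
      rintro rfl
      have := congrArg (eval 0) (hTdef.symm.trans hTj)
      simp [ht.symm] at this
    obtain ⟨i, rfl⟩ := Nat.exists_eq_succ_of_ne_zero hj
    have h1 : r = -(C t * X ^ i) := by
      apply mul_left_cancel₀ (X_ne_zero (R := ℂ))
      have := hTdef.symm.trans hTj
      rw [Nat.cast_zero, C_0, zero_mul, zero_sub, pow_succ] at this
      linear_combination -this
    have hi : i = 0 := by
      by_contra hi
      exact hrw 0 h0 (by simp [h1, hi])
    have h2 : r.natDegree = 0 := by
      rw [h1, hi]
      simp
    obtain ⟨x, y, hxy⟩ := exists_eq_X_add_C_of_natDegree_le_one (p := radical Q) (by omega)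
    have h3 := (hqw 0).2 h0
    have h4 := (hqw a).2 ha
    rw [hxy] at h3 h4
    simp only [eval_add, eval_mul, eval_C, eval_X, mul_zero, zero_add] at h3 h4
    rw [h3, add_zero, mul_eq_zero, or_iff_left ha0] at h4
    exact radical_ne_zero (a := Q) (by rw [hxy, h3, h4]; simp)
  have hq0 : (radical Q).eval 0 ≠ 0 := by rwa [Ne, hqw]
  have hcases : m = 0 ∧ j = (radical Q).natDegree ∨ m = Q.natDegree ∧ j = 0 := by
    by_cases hm : m = 0
    · refine Or.inl ⟨hm, ?_⟩
      by_contra hj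
      rw [hTj, coeff_C_mul_X_pow, if_neg (Ne.symm hj), hm] at hT_lead
      simp [hQd0] at hT_lead
    · have hj : j = 0 := by
        by_contra hj
        have := congrArg (eval 0) (hTdef.symm.trans hTj)
        simp [hj, hm, hq0] at this
      refine Or.inr ⟨?_, hj⟩
      rw [hTj, coeff_C_mul_X_pow, if_neg (by omega)] at hT_lead
      have h1 := (mul_eq_zero.1 hT_lead.symm).resolve_right
        (leadingCoeff_ne_zero.2 radical_ne_zero)
      exact_mod_cast sub_eq_zero.1 h1
  have hshare : ∀ w : ℂ, w ≠ 0 → Q.eval w ≠ 0 →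
      l * (c * w ^ m * (g.eval w * (t * w ^ j))) = b * Q.eval w ^ 2 →
      c * w ^ m = b * Q.eval w := by
    intro w hw hQw h
    have h1 := (hshareb w hw hQw).2 (by rw [mul_assoc, key, hTj]; simpa using h)
    simpa [hPc] using h1
  have hH : C (l * t) * X ^ j - radical Q ≠ 0 := by
    intro h
    rcases hcases with ⟨-, hj⟩ | ⟨-, hj⟩
    · have := congrArg (eval 0) h
      simp [hj, hqd0, hq0] at this
    · rw [sub_eq_zero] at h
      apply hqd0
      rw [← h, hj, pow_zero, mul_one, natDegree_C]
  have hdeg := natDegree_le_natDegree_radical_of_share hl hb hc ht hQ0 hg hqd0 hT_le (by omega)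
    hH hshare
  have hqd : (radical Q).natDegree = Q.natDegree := by omega
  have hdQ : d = Q.natDegree := by omega
  obtain ⟨γ, hγ⟩ := natDegree_eq_zero.1 (show g.natDegree = 0 by omega)
  have hcoeff : ∀ n, n ≠ 0 → n ≠ Q.natDegree → Q.coeff n = 0 := by
    intro n hn0 hnd
    obtain ⟨i, rfl⟩ := Nat.exists_eq_succ_of_ne_zero hn0
    have h1 := congrArg (fun p => coeff p (i + 1)) hgT
    simp only [hTj, ← hγ, coeff_sub, coeff_C_mul, coeff_X_mul, coeff_derivative,
      coeff_X_pow] at h1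
    rw [if_neg (by omega)] at h1
    have h2 : ((m : ℂ) - (i + 1 : ℕ)) * Q.coeff (i + 1) = 0 := by
      push_cast
      linear_combination h1
    refine (mul_eq_zero.1 h2).resolve_left fun h3 => ?_
    have h4 : m = i + 1 := by exact_mod_cast sub_eq_zero.1 h3
    omega
  have hQe := eq_C_mul_X_pow_add_C_of_coeff hQd0 hcoeff
  have hα := leadingCoeff_ne_zero.2 hQ
  generalize Q.leadingCoeff = α at hQe hα
  generalize Q.eval 0 = β at hQe hQ0
  rw [← hdQ] at hQe
  have hQw : ∀ w, Q.eval w = α * w ^ d + β := fun w => by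
    conv_lhs => rw [hQe]
    simp
  have hgw : ∀ w, g.eval w * (t * w ^ j) = m * (α * w ^ d + β) - d * (α * w ^ d) := by
    intro w
    have h1 : X * derivative Q = C (d : ℂ) * (C α * X ^ d) := by
      rw [hQe, derivative_add, derivative_C, add_zero, X_mul_derivative_C_mul_X_pow]
    rw [h1, hTj] at hgT
    simpa [hQw] using (congrArg (eval w) hgT).symm
  simp only [hgw, hQw] at hshare
  have hd0 : d ≠ 0 := by omega
  rcases hcases with ⟨hm, -⟩ | ⟨hm, -⟩
  · left
    obtain ⟨h1, h2⟩ := normal_form_of_const_num hd0 hl hb hc hα hQ0 (by simpa [hm] using hshare)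
    refine ⟨α / β, div_ne_zero hα hQ0, h2, fun w _ hw hw' => ?_⟩
    rw [hQw] at hw ⊢
    rw [div_eq_div_iff hw hw', hPc, hm, h1]
    simp only [eval_mul, eval_C, pow_zero, eval_one]
    field_simp
    ring
  · right
    rw [← hdQ] at hm
    subst hm
    obtain ⟨h1, h2⟩ := normal_form_of_pow_num hd0 hl hb hc hα hQ0 fun w hw hw' h =>
      hshare w hw hw' (by linear_combination h)
    refine ⟨β / α, div_ne_zero hQ0 hα, h2, fun w _ hw hw' => ?_⟩
    rw [hQw] at hw ⊢
    rw [div_eq_div_iff hw hw', hPc, h1]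
    simp only [eval_mul, eval_C, eval_pow, eval_X]
    field_simp
end

section
/- Fix λ ∈ ℂ with λ ≠ 0, let R = P/Q be a non-constant rational function of degree d = max(deg P, deg Q) (P, Q ∈ ℂ[X] coprime, Q ≠ 0, d ≥ 1), and let a, b ∈ ℂ∖{0} with a ≠ b. Suppose R and ∂_z R share the value a in ℂ* and share the value b in ℂ*. Let n_∞ be the number of distinct roots of Q in ℂ∖{0} (the number of distinct poles of R in ℂ*). Then 2·n_∞ ≥ d, or P·Q = λ·X·(P'·Q − P·Q') in ℂ[X] (i.e., R ≡ ∂_z R). -/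
open Polynomial

/-- If `Q * T = X * S * Q'`, then `(twistedDeriv S T A) / (Q * S)` is `X` times the derivative
of `A / Q`. -/
noncomputable def twistedDeriv (S T A : ℂ[X]) : ℂ[X] := X * S * derivative A - A * T

lemma derivative_ne_zero_of_isRoot {A : ℂ[X]} {w : ℂ} (hA : A ≠ 0) (hw : A.IsRoot w) :
    derivative A ≠ 0 := by
  intro h0
  rw [eq_C_of_natDegree_eq_zero (derivative_eq_zero.1 h0)] at hw hA
  simp at hw hA
  exact hA hw

lemma natDegree_twistedDeriv_le {S T : ℂ[X]} {n : ℕ} (hS : S.natDegree ≤ n)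
    (hT : T.natDegree ≤ n) (A : ℂ[X]) :
    (twistedDeriv S T A).natDegree ≤ A.natDegree + n := by
  refine (natDegree_sub_le _ _).trans (max_le ?_ (natDegree_mul_le.trans (by omega)))
  rcases Nat.eq_zero_or_pos A.natDegree with h | h
  · rw [derivative_of_natDegree_zero h]
    simp
  · have h1 := natDegree_mul_le (p := X * S) (q := derivative A)
    have h2 := natDegree_mul_le (p := (X : ℂ[X])) (q := S)
    have h3 := natDegree_derivative_lt h.ne'
    have h4 := natDegree_X_le (R := ℂ)
    omega

lemma X_pow_dvd_twistedDeriv {S T A : ℂ[X]} {m : ℕ} (h : X ^ m ∣ A) :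
    X ^ m ∣ twistedDeriv S T A := by
  refine dvd_sub ?_ (h.mul_right T)
  obtain ⟨B, rfl⟩ := h
  cases m with
  | zero => simp
  | succ m =>
    refine ⟨S * ((m + 1 : ℂ[X]) * B + X * derivative B), ?_⟩
    simp only [derivative_mul, derivative_X_pow]
    push_cast
    simp
    ring

lemma not_X_sub_C_pow_dvd_twistedDeriv {S T A : ℂ[X]} {w : ℂ} (hA : A ≠ 0)
    (hAw : A.IsRoot w) (hw : w ≠ 0) (hS : S.eval w ≠ 0) :
    ¬ (X - C w) ^ A.rootMultiplicity w ∣ twistedDeriv S T A := by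
  intro h
  have h1 : (X - C w) ^ A.rootMultiplicity w ∣ X * S * derivative A :=
    (dvd_sub_left ((pow_rootMultiplicity_dvd A w).mul_right T)).1 h
  have h2 := (prime_X_sub_C w).pow_dvd_of_dvd_mul_left _
    (by rw [dvd_iff_isRoot]; simp [hw, hS]) h1
  have h4 := (le_rootMultiplicity_iff (derivative_ne_zero_of_isRoot hA hAw)).2 h2
  rw [derivative_rootMultiplicity_of_root hAw] at h4
  have := (rootMultiplicity_pos hA).2 hAw
  omega

lemma rootMultiplicity_le_twistedDeriv {S T A : ℂ[X]} {w : ℂ} (hA : A ≠ 0)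
    (hAw : A.IsRoot w) (hw : w ≠ 0) (hS : S.eval w ≠ 0) :
    A.rootMultiplicity w ≤ (twistedDeriv S T A).rootMultiplicity w + 1 := by
  have h0 : twistedDeriv S T A ≠ 0 := fun h =>
    not_X_sub_C_pow_dvd_twistedDeriv (T := T) hA hAw hw hS (h ▸ dvd_zero _)
  have h4 := derivative_rootMultiplicity_of_root hAw
  rw [← Nat.sub_le_iff_le_add, le_rootMultiplicity_iff h0]
  refine dvd_sub ?_ ?_
  · rw [← h4]
    exact (pow_rootMultiplicity_dvd _ w).mul_left _
  · exact ((pow_dvd_pow _ (Nat.sub_le _ _)).trans (pow_rootMultiplicity_dvd A w)).mul_right T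

lemma exists_logDeriv (Q : ℂ[X]) (hQ : Q ≠ 0) :
    ∃ S T : ℂ[X], S.Monic ∧ S.natDegree = (Q.roots.toFinset.filter (fun z => z ≠ 0)).card ∧
      (∀ w, S.eval w = 0 ↔ w ≠ 0 ∧ Q.eval w = 0) ∧
      T.natDegree ≤ (Q.roots.toFinset.filter (fun z => z ≠ 0)).card ∧
      Q * T = X * S * derivative Q ∧ ∀ w, Q.eval w = 0 → T.eval w ≠ 0 := by
  set N := Q.roots.toFinset.filter (fun z => z ≠ 0) with hN
  have hSm : (∏ z ∈ N, (X - C z)).Monic := monic_prod_X_sub_C _ _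
  have hSd : (∏ z ∈ N, (X - C z)).natDegree = N.card := natDegree_finsetProd_X_sub_C_eq_card _ _
  have hS0 : ∀ w, (∏ z ∈ N, (X - C z)).eval w = 0 ↔ w ≠ 0 ∧ Q.eval w = 0 := by
    intro w
    simp [eval_prod, Finset.prod_eq_zero_iff, hN, sub_eq_zero, hQ]
    tauto
  have hXSne : X * ∏ z ∈ N, (X - C z) ≠ 0 := mul_ne_zero X_ne_zero hSm.ne_zero
  have hXS : ∀ w, Q.eval w = 0 → (X * ∏ z ∈ N, (X - C z)).rootMultiplicity w = 1 := by
    intro w hw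
    have hroots : (X * ∏ z ∈ N, (X - C z)).roots = (0 : ℂ) ::ₘ N.val := by
      rw [roots_mul hXSne, roots_X, roots_prod_X_sub_C]
      rfl
    have hnd : (X * ∏ z ∈ N, (X - C z)).roots.Nodup := by
      rw [hroots, Multiset.nodup_cons]
      exact ⟨by simp [hN], N.nodup⟩
    rw [← count_roots, Multiset.count_eq_one_of_mem hnd]
    rw [hroots]
    by_cases h : w = 0 <;> simp [h, hN, hQ, hw]
  have hdQ : ∀ w, Q.eval w = 0 → derivative Q ≠ 0 :=
    fun w hw => derivative_ne_zero_of_isRoot hQ hw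
  have hmult : ∀ w, Q.eval w = 0 →
      (X * (∏ z ∈ N, (X - C z)) * derivative Q).rootMultiplicity w = Q.rootMultiplicity w := by
    intro w hw
    rw [rootMultiplicity_mul (mul_ne_zero hXSne (hdQ w hw)), hXS w hw,
      derivative_rootMultiplicity_of_root hw]
    have := (rootMultiplicity_pos hQ).2 hw
    omega
  have hdvd : Q ∣ X * (∏ z ∈ N, (X - C z)) * derivative Q := by
    refine (IsAlgClosed.splits Q).dvd_of_roots_le_roots hQ (Multiset.le_iff_count.2 fun w => ?_)
    by_cases hw : Q.eval w = 0
    · rw [count_roots, count_roots, hmult w hw]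
    · rw [count_roots, rootMultiplicity_eq_zero hw]
      exact Nat.zero_le _
  obtain ⟨T, hT⟩ := hdvd
  refine ⟨_, T, hSm, hSd, hS0, ?_, hT.symm, ?_⟩
  · by_cases hT0 : T = 0
    · simp [hT0]
    have hd0 : derivative Q ≠ 0 := by
      rintro h
      rw [h, mul_zero] at hT
      exact mul_ne_zero hQ hT0 hT.symm
    have h1 := congrArg natDegree hT
    rw [natDegree_mul hXSne hd0, natDegree_mul X_ne_zero hSm.ne_zero, natDegree_mul hQ hT0,
      natDegree_X, hSd] at h1
    have h2 : Q.natDegree ≠ 0 := fun h => hd0 (derivative_of_natDegree_zero h)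
    have := natDegree_derivative_lt h2
    omega
  · intro w hw hTw
    have hT0 : T ≠ 0 := by
      rintro rfl
      exact mul_ne_zero hXSne (hdQ w hw) (by rw [hT, mul_zero])
    have h1 := hmult w hw
    rw [hT, rootMultiplicity_mul (mul_ne_zero hQ hT0)] at h1
    have := (rootMultiplicity_pos hT0).2 hTw
    omega

lemma coeff_X_mul_derivative (A : ℂ[X]) (m : ℕ) :
    (X * derivative A).coeff m = m * A.coeff m := by
  cases m with
  | zero => simp
  | succ m =>
    rw [coeff_X_mul, coeff_derivative]
    push_cast
    ring

lemma coeff_twistedDeriv {S T A : ℂ[X]} {n m : ℕ} (hS : S.natDegree ≤ n)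
    (hT : T.natDegree ≤ n) (hA : A.natDegree ≤ m) :
    (twistedDeriv S T A).coeff (m + n) = A.coeff m * (m * S.coeff n - T.coeff n) := by
  have hd : (X * derivative A).natDegree ≤ m := by
    refine natDegree_le_iff_coeff_eq_zero.2 fun N hN => ?_
    rw [coeff_X_mul_derivative, coeff_eq_zero_of_natDegree_lt (hA.trans_lt hN), mul_zero]
  have h : twistedDeriv S T A = X * derivative A * S - A * T := by
    rw [twistedDeriv]
    ring
  rw [h, coeff_sub, coeff_mul_add_eq_of_natDegree_le hd hS, coeff_mul_add_eq_of_natDegree_le hA hT,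
    coeff_X_mul_derivative]
  ring

lemma isCoprime_eval_ne_zero {P Q : ℂ[X]} (h : IsCoprime P Q) {w : ℂ} (hP : P.eval w = 0) :
    Q.eval w ≠ 0 := by
  obtain ⟨u, v, huv⟩ := h
  intro hQ
  simpa [hP, hQ] using congrArg (eval w) huv

lemma twistedDeriv_twistedDeriv_sub {S T P Q : ℂ[X]} (hQT : Q * T = X * S * derivative Q)
    (l a : ℂ) :
    twistedDeriv S (T + X * derivative S) (C l * twistedDeriv S T P) =
      twistedDeriv S (T + X * derivative S) (C l * twistedDeriv S T P - C a * (Q * S)) := by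
  simp only [twistedDeriv, derivative_sub, derivative_mul, derivative_C]
  linear_combination (-C a * S) * hQT

/-- The numerator of `∂_z R - a`, written over `Q * S`, has degree at least `deg R + deg S`. -/
lemma coeff_twistedDeriv_sub_ne_zero {S T P Q : ℂ[X]} {l a : ℂ} {n : ℕ} (hl : l ≠ 0) (ha : a ≠ 0)
    (hQ : Q ≠ 0) (hSm : S.Monic) (hSn : S.natDegree = n) (hTn : T.natDegree ≤ n)
    (hQT : Q * T = X * S * derivative Q) :
    (C l * twistedDeriv S T P - C a * (Q * S)).coeff (max P.natDegree Q.natDegree + n) ≠ 0 := by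
  set d := max P.natDegree Q.natDegree with hd
  have hPd : P.natDegree ≤ d := le_max_left _ _
  have hQd : Q.natDegree ≤ d := le_max_right _ _
  have hS1 : S.coeff n = 1 := hSn ▸ hSm.coeff_natDegree
  have hTc : T.coeff n = Q.natDegree := by
    have h := coeff_twistedDeriv hSn.le hTn (le_refl Q.natDegree)
    have h0 : twistedDeriv S T Q = 0 := by rw [twistedDeriv, hQT, sub_self]
    rw [h0, hS1, coeff_zero, eq_comm, mul_eq_zero] at h
    rcases h with h | h
    · exact absurd h (leadingCoeff_ne_zero.2 hQ)
    · linear_combination -h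
  rw [coeff_sub, coeff_C_mul, coeff_C_mul, coeff_twistedDeriv hSn.le hTn hPd,
    coeff_mul_add_eq_of_natDegree_le hQd hSn.le, hS1, hTc]
  rcases hQd.lt_or_eq with h | h
  · have hPd' : P.natDegree = d := by omega
    have hP0 : P ≠ 0 := by
      rintro rfl
      rw [natDegree_zero] at hPd'
      omega
    have hPc : P.coeff d ≠ 0 := hPd' ▸ leadingCoeff_ne_zero.2 hP0
    rw [coeff_eq_zero_of_natDegree_lt h]
    have : (d : ℂ) - Q.natDegree ≠ 0 := by
      rw [sub_ne_zero]
      exact_mod_cast h.ne'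
    simp [hl, hPc, this]
  · have hQc : Q.coeff d ≠ 0 := h ▸ leadingCoeff_ne_zero.2 hQ
    simp [h, hQc, ha]

/-- Counting data for a non-zero value `a` shared by `R = P / Q` and `∂_z R` in `ℂ*`. -/
lemma shared_value_count {S T P Q : ℂ[X]} {l a : ℂ} {n : ℕ} (hl : l ≠ 0) (ha : a ≠ 0)
    (hPQ : IsCoprime P Q) (hQ : Q ≠ 0) (hd1 : 1 ≤ max P.natDegree Q.natDegree)
    (hSm : S.Monic) (hSn : S.natDegree = n) (hTn : T.natDegree ≤ n)
    (hQT : Q * T = X * S * derivative Q)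
    (hS0 : ∀ w, S.eval w = 0 ↔ w ≠ 0 ∧ Q.eval w = 0)
    (hT0 : ∀ w, Q.eval w = 0 → T.eval w ≠ 0)
    (hshare : ∀ w : ℂ, w ≠ 0 → Q.eval w ≠ 0 →
      (P.eval w = a * Q.eval w ↔
        l * w * (derivative P * Q - P * derivative Q).eval w = a * (Q.eval w) ^ 2)) :
    ∃ E : Finset ℂ, (∀ w ∈ E, w ≠ 0 ∧ Q.eval w ≠ 0 ∧ P.eval w = a * Q.eval w ∧
        (P * S - C l * twistedDeriv S T P).eval w = 0) ∧
      (P - C a * Q).natDegree ≤ (P - C a * Q).rootMultiplicity 0 + E.card ∧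
      max P.natDegree Q.natDegree + n ≤ ∑ w ∈ E,
        (twistedDeriv S (T + X * derivative S) (C l * twistedDeriv S T P)).rootMultiplicity w
          + E.card ∧
      twistedDeriv S (T + X * derivative S) (C l * twistedDeriv S T P) ≠ 0 ∧
      (P - C a * Q).rootMultiplicity 0 ≤
        (twistedDeriv S (T + X * derivative S) (C l * twistedDeriv S T P)).rootMultiplicity 0 ∧
      (twistedDeriv S (T + X * derivative S) (C l * twistedDeriv S T P)).natDegree ≤
        (P - C a * Q).natDegree + n + n := by
  set A := P - C a * Q with hA
  set U := C l * twistedDeriv S T P with hU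
  set Ua := U - C a * (Q * S) with hUa
  have hUA : U = C l * twistedDeriv S T A := by
    simp only [hU, hA, twistedDeriv, derivative_sub, derivative_mul, derivative_C]
    linear_combination (-C l * C a) * hQT
  have hVUa : twistedDeriv S (T + X * derivative S) U =
      twistedDeriv S (T + X * derivative S) Ua := twistedDeriv_twistedDeriv_sub hQT l a
  set V := twistedDeriv S (T + X * derivative S) U with hV
  have hAe : ∀ w, A.eval w = 0 ↔ P.eval w = a * Q.eval w := by
    intro w
    simp [hA, sub_eq_zero]
  have hA0 : A ≠ 0 := by
    intro h
    have hP : P = C a * Q := sub_eq_zero.1 h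
    have hu : IsUnit Q := by
      rw [hP] at hPQ
      exact isCoprime_self.1 hPQ.of_mul_left_right
    have h1 := natDegree_eq_zero_of_isUnit hu
    have h2 : P.natDegree ≤ Q.natDegree := hP ▸ natDegree_C_mul_le _ _
    omega
  have hAQ : ∀ w, A.eval w = 0 → Q.eval w ≠ 0 := by
    intro w hw hQw
    have hPw := (hAe w).1 hw
    rw [hQw, mul_zero] at hPw
    exact isCoprime_eval_ne_zero hPQ hPw hQw
  have hUshare : ∀ w, w ≠ 0 → Q.eval w ≠ 0 → (A.eval w = 0 ↔ Ua.eval w = 0) := by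
    intro w hw hQw
    have hSw : S.eval w ≠ 0 := fun h => hQw ((hS0 w).1 h).2
    rw [hAe, hshare w hw hQw]
    have h1 : U.eval w * Q.eval w =
        S.eval w * (l * w * (derivative P * Q - P * derivative Q).eval w) := by
      have h2 := congrArg (eval w) hQT
      simp only [hU, twistedDeriv, eval_mul, eval_sub, eval_C, eval_X] at h2 ⊢
      linear_combination (-l * P.eval w) * h2
    have h3 : Ua.eval w * Q.eval w = S.eval w *
        (l * w * (derivative P * Q - P * derivative Q).eval w - a * Q.eval w ^ 2) := by
      rw [mul_sub, ← h1]
      simp only [hUa, eval_mul, eval_sub, eval_C]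
      ring
    constructor
    · intro h
      rw [h, sub_self, mul_zero] at h3
      exact (mul_eq_zero.1 h3).resolve_right hQw
    · intro h
      rw [h, zero_mul] at h3
      exact sub_eq_zero.1 ((mul_eq_zero.1 h3.symm).resolve_left hSw)
  have hUroot : ∀ w, Ua.eval w = 0 → w ≠ 0 ∧ Q.eval w ≠ 0 := by
    intro w hw
    have h2 := congrArg (eval w) hQT
    by_cases hQw : Q.eval w = 0
    · have hwS : w * S.eval w = 0 := by
        by_cases h : w = 0
        · simp [h]
        · rw [(hS0 w).2 ⟨h, hQw⟩, mul_zero]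
      simp only [hUa, hU, twistedDeriv, eval_mul, eval_sub, eval_C, eval_X, hQw, hwS] at hw
      have hPw : P.eval w ≠ 0 := fun h => isCoprime_eval_ne_zero hPQ h hQw
      simp [hl, hPw, hT0 w hQw] at hw
    · refine ⟨?_, hQw⟩
      rintro rfl
      have hS : S.eval 0 ≠ 0 := fun h => ((hS0 0).1 h).1 rfl
      simp only [eval_mul, eval_X, zero_mul, mul_eq_zero, hQw, false_or] at h2
      simp only [hUa, hU, twistedDeriv, eval_mul, eval_sub, eval_C, eval_X, h2] at hw
      simp [ha, hQw, hS] at hw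
  have hUcoeff : Ua.coeff (max P.natDegree Q.natDegree + n) ≠ 0 :=
    coeff_twistedDeriv_sub_ne_zero hl ha hQ hSm hSn hTn hQT
  have hUdeg := le_natDegree_of_ne_zero hUcoeff
  have hUa0 : Ua ≠ 0 := by
    intro h
    simp [h] at hUcoeff
  set E := A.roots.toFinset.filter (fun z => z ≠ 0) with hE
  have hEmem : ∀ w, w ∈ E ↔ A.eval w = 0 ∧ w ≠ 0 := by
    intro w
    simp [hE, hA0]
  have hEU : ∀ w, w ∈ E ↔ Ua.eval w = 0 := by
    intro w
    rw [hEmem]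
    constructor
    · rintro ⟨h, hw⟩
      exact (hUshare w hw (hAQ w h)).1 h
    · intro h
      obtain ⟨hw, hQw⟩ := hUroot w h
      exact ⟨(hUshare w hw hQw).2 h, hw⟩
  have hES : ∀ w ∈ E, S.eval w ≠ 0 := by
    intro w hw h
    exact hAQ w ((hEmem w).1 hw).1 ((hS0 w).1 h).2
  have hV0 : V ≠ 0 := by
    have hdeg : Ua.degree ≠ 0 := by
      intro h
      have h0 : Ua.natDegree = 0 := natDegree_eq_zero_iff_degree_le_zero.2 h.le
      omega
    obtain ⟨w, hw⟩ := IsAlgClosed.exists_root Ua hdeg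
    have hwE := (hEU w).2 hw
    intro h
    refine not_X_sub_C_pow_dvd_twistedDeriv (T := T + X * derivative S) hUa0 hw
      ((hEmem w).1 hwE).2 (hES w hwE) ?_
    rw [← hVUa, h]
    exact dvd_zero _
  refine ⟨E, ?_, ?_, ?_, hV0, ?_, ?_⟩
  · intro w hw
    obtain ⟨h1, h2⟩ := (hEmem w).1 hw
    refine ⟨h2, hAQ w h1, (hAe w).1 h1, ?_⟩
    have h3 := (hEU w).1 hw
    simp only [hUa, eval_sub, eval_mul, eval_C] at h3 ⊢
    linear_combination S.eval w * (hAe w).1 h1 - h3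
  · have hsimple : ∀ w ∈ E, A.rootMultiplicity w = 1 := by
      intro w hw
      obtain ⟨h1, h2⟩ := (hEmem w).1 hw
      have h3 := (hEU w).1 hw
      have hpos := (rootMultiplicity_pos hA0).2 h1
      by_contra hne
      have h4 : (derivative A).IsRoot w :=
        ((one_lt_rootMultiplicity_iff_isRoot hA0).1 (by omega)).2
      rw [hUa, hUA] at h3
      simp only [twistedDeriv, eval_mul, eval_sub, eval_C, eval_X, h1, h4.eq_zero] at h3
      simp [ha, hAQ w h1, hES w hw] at h3
    have hsum : ∑ w ∈ insert 0 E, A.roots.count w = A.roots.card := by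
      refine Multiset.sum_count_eq_card fun w hw => ?_
      rw [Finset.mem_insert, hEmem]
      have : A.eval w = 0 := (mem_roots hA0).1 hw
      tauto
    rw [Finset.sum_insert (by simp [hE])] at hsum
    simp only [count_roots] at hsum
    rw [Finset.sum_congr rfl hsimple, IsAlgClosed.card_roots_eq_natDegree] at hsum
    simp at hsum
    exact hsum.ge
  · have hsum : ∑ w ∈ E, Ua.roots.count w = Ua.roots.card :=
      Multiset.sum_count_eq_card fun w hw => (hEU w).2 ((mem_roots hUa0).1 hw)
    rw [IsAlgClosed.card_roots_eq_natDegree] at hsum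
    rw [← hsum] at hUdeg
    refine hUdeg.trans ?_
    rw [Finset.card_eq_sum_ones, ← Finset.sum_add_distrib]
    refine Finset.sum_le_sum fun w hw => ?_
    rw [count_roots, hVUa]
    exact rootMultiplicity_le_twistedDeriv hUa0 ((hEU w).1 hw) ((hEmem w).1 hw).2 (hES w hw)
  · rw [le_rootMultiplicity_iff hV0, C_0, sub_zero]
    refine X_pow_dvd_twistedDeriv ?_
    rw [hUA]
    refine (X_pow_dvd_twistedDeriv ?_).mul_left _
    simpa using pow_rootMultiplicity_dvd A 0
  · have hT2 : (T + X * derivative S).natDegree ≤ n := by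
      refine natDegree_add_le_of_degree_le hTn ?_
      refine natDegree_le_iff_coeff_eq_zero.2 fun N hN => ?_
      rw [coeff_X_mul_derivative, coeff_eq_zero_of_natDegree_lt (hSn.le.trans_lt hN), mul_zero]
    refine (natDegree_twistedDeriv_le hSn.le hT2 U).trans (Nat.add_le_add_right ?_ n)
    rw [hUA]
    exact (natDegree_C_mul_le _ _).trans (natDegree_twistedDeriv_le hSn.le hTn A)

/-- If a non-constant rational function `R = P/Q` of degree `d` and `∂_z R` share two
finite non-zero values in `ℂ*`, and `n_∞` is the number of distinct poles of `R` in
`ℂ*`, then `n_∞ ≥ d/2` or `R ≡ ∂_z R`. -/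
theorem R_dzR_share_two_values_pole_count
    (l : ℂ) (hl : l ≠ 0)
    (P Q : ℂ[X]) (hPQ : IsCoprime P Q) (hQ : Q ≠ 0)
    (d : ℕ) (hd : d = max P.natDegree Q.natDegree) (hd1 : 1 ≤ d)
    (a b : ℂ) (ha : a ≠ 0) (hb : b ≠ 0) (hab : a ≠ b)
    (hsharea : ∀ w : ℂ, w ≠ 0 → Q.eval w ≠ 0 →
      (P.eval w = a * Q.eval w ↔
        l * w * (derivative P * Q - P * derivative Q).eval w = a * (Q.eval w) ^ 2))
    (hshareb : ∀ w : ℂ, w ≠ 0 → Q.eval w ≠ 0 →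
      (P.eval w = b * Q.eval w ↔
        l * w * (derivative P * Q - P * derivative Q).eval w = b * (Q.eval w) ^ 2)) :
    d ≤ 2 * (Q.roots.toFinset.filter (fun z => z ≠ 0)).card ∨
      P * Q = C l * X * (derivative P * Q - P * derivative Q) := by
  by_contra! hcon
  obtain ⟨hn, hF⟩ := hcon
  obtain ⟨S, T, hSm, hSn, hS0, hTn, hQT, hT0⟩ := exists_logDeriv Q hQ
  set n := (Q.roots.toFinset.filter (fun z => z ≠ 0)).card
  rw [hd] at hd1 hn
  obtain ⟨E, hE, hEA, hEV, -, hE0, hEd⟩ :=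
    shared_value_count hl ha hPQ hQ hd1 hSm hSn hTn hQT hS0 hT0 hsharea
  obtain ⟨F, hFb, hFB, hFV, -, hF0, hFd⟩ :=
    shared_value_count hl hb hPQ hQ hd1 hSm hSn hTn hQT hS0 hT0 hshareb
  set V := twistedDeriv S (T + X * derivative S) (C l * twistedDeriv S T P)
  have hdisj : Disjoint E F := by
    rw [Finset.disjoint_left]
    intro w h1 h2
    have h3 := (hE w h1).2.2.1.symm.trans (hFb w h2).2.2.1
    exact hab (mul_right_cancel₀ (hE w h1).2.1 h3)
  have hG0 : P * S - C l * twistedDeriv S T P ≠ 0 := by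
    intro h
    apply hF
    have h1 : S * (P * Q - C l * X * (derivative P * Q - P * derivative Q)) = 0 := by
      rw [twistedDeriv] at h
      linear_combination Q * h - C l * P * hQT
    exact sub_eq_zero.1 ((mul_eq_zero.1 h1).resolve_left hSm.ne_zero)
  have hGd : (P * S - C l * twistedDeriv S T P).natDegree ≤ P.natDegree + n := by
    refine (natDegree_sub_le _ _).trans (max_le ?_ ?_)
    · exact natDegree_mul_le.trans (by omega)
    · exact (natDegree_C_mul_le _ _).trans (natDegree_twistedDeriv_le hSn.le hTn P)
  have hcard : E.card + F.card ≤ P.natDegree + n := by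
    rw [← Finset.card_union_of_disjoint hdisj]
    refine (card_le_degree_of_subset_roots fun w hw => ?_).trans hGd
    rw [mem_roots hG0]
    rcases Finset.mem_union.1 hw with h | h
    · exact (hE w h).2.2.2
    · exact (hFb w h).2.2.2
  have hsum : V.rootMultiplicity 0 + (∑ w ∈ E, V.rootMultiplicity w
      + ∑ w ∈ F, V.rootMultiplicity w) ≤ V.natDegree := by
    have h0 : (0 : ℂ) ∉ E ∪ F := by
      intro h
      rcases Finset.mem_union.1 h with h | h
      · exact (hE 0 h).1 rfl
      · exact (hFb 0 h).1 rfl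
    rw [← Finset.sum_union hdisj, ← Finset.sum_insert (f := fun w => V.rootMultiplicity w) h0,
      ← IsAlgClosed.card_roots_eq_natDegree]
    simp only [← count_roots]
    have h1 : ∑ w ∈ insert 0 (E ∪ F) ∪ V.roots.toFinset, V.roots.count w = V.roots.card :=
      Multiset.sum_count_eq_card fun w hw =>
        Finset.mem_union_right _ (Multiset.mem_toFinset.2 hw)
    rw [← h1]
    exact Finset.sum_le_sum_of_subset Finset.subset_union_left
  have hmin : (P - C a * Q).rootMultiplicity 0 = 0 ∨ (P - C b * Q).rootMultiplicity 0 = 0 := by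
    by_contra! h
    have h1 := (rootMultiplicity_pos'.1 (Nat.pos_of_ne_zero h.1)).2
    have h2 := (rootMultiplicity_pos'.1 (Nat.pos_of_ne_zero h.2)).2
    simp only [IsRoot.def, eval_sub, eval_mul, eval_C] at h1 h2
    have h3 : (b - a) * Q.eval 0 = 0 := by linear_combination h1 - h2
    have hQ0 := (mul_eq_zero.1 h3).resolve_left (sub_ne_zero.2 hab.symm)
    rw [hQ0, mul_zero, sub_zero] at h1
    exact isCoprime_eval_ne_zero hPQ h1 hQ0
  have hmax : max P.natDegree Q.natDegree ≤
      max (P - C a * Q).natDegree (P - C b * Q).natDegree := by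
    have hba : b - a ≠ 0 := sub_ne_zero.2 hab.symm
    have h1 : C (b - a) * Q = (P - C a * Q) - (P - C b * Q) := by
      rw [C_sub]
      ring
    have h2 : C (b - a) * P = C b * (P - C a * Q) - C a * (P - C b * Q) := by
      rw [C_sub]
      ring
    refine max_le ?_ ?_
    · rw [← natDegree_C_mul hba, h2]
      refine (natDegree_sub_le _ _).trans (max_le_max ?_ ?_) <;> exact natDegree_C_mul_le _ _
    · rw [← natDegree_C_mul hba, h1]
      exact natDegree_sub_le _ _
  omega
end

section
/- Fix λ ∈ ℂ with λ ≠ 0, let R = P/Q be a non-constant rational function of degree d = max(deg P, deg Q) with 1 ≤ d ≤ 2 (P, Q ∈ ℂ[X] coprime, Q ≠ 0), and let a, b ∈ ℂ∖{0} with a ≠ b. If R and ∂_z R share the value a in ℂ* and share the value b in ℂ*, then P·Q = λ·X·(P'·Q − P·Q') in ℂ[X] (i.e., R ≡ ∂_z R). -/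
open Polynomial

theorem eq_C_mul_X_sub_C_pow_of_unique_root (p : ℂ[X]) (w : ℂ)
    (h : ∀ z, p.eval z = 0 → z = w) :
    p = C p.leadingCoeff * (X - C w) ^ p.natDegree := by
  rcases eq_or_ne p 0 with rfl | hp
  · simp
  have hs : p.Splits := IsAlgClosed.splits p
  have hr : p.roots = Multiset.replicate p.natDegree w := by
    rw [Multiset.eq_replicate]
    exact ⟨hs.natDegree_eq_card_roots.symm, fun z hz => h z (mem_roots'.1 hz).2⟩
  conv_lhs => rw [hs.eq_prod_roots, hr]
  simp

theorem quadratic_coeffs_of_unique_root (c₂ c₁ c₀ w : ℂ) (h₂ : c₂ ≠ 0)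
    (h : ∀ z, c₂ * z ^ 2 + c₁ * z + c₀ = 0 → z = w) :
    c₁ = -2 * c₂ * w ∧ c₀ = c₂ * w ^ 2 := by
  have key := eq_C_mul_X_sub_C_pow_of_unique_root (C c₂ * X ^ 2 + C c₁ * X + C c₀) w
    (by simpa using h)
  rw [leadingCoeff_quadratic h₂, natDegree_quadratic h₂] at key
  have e (z : ℂ) := congrArg (eval z) key
  simp only [eval_add, eval_mul, eval_C, eval_pow, eval_X, eval_sub] at e
  have e0 := e 0
  have e1 := e 1
  constructor <;> grind

theorem cubic_coeffs_of_unique_root (c₃ c₂ c₁ c₀ w : ℂ) (h₃ : c₃ ≠ 0)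
    (h : ∀ z, c₃ * z ^ 3 + c₂ * z ^ 2 + c₁ * z + c₀ = 0 → z = w) :
    c₂ = -3 * c₃ * w ∧ c₁ = 3 * c₃ * w ^ 2 ∧ c₀ = -c₃ * w ^ 3 := by
  have key := eq_C_mul_X_sub_C_pow_of_unique_root
    (C c₃ * X ^ 3 + C c₂ * X ^ 2 + C c₁ * X + C c₀) w (by simpa using h)
  rw [leadingCoeff_cubic h₃, natDegree_cubic h₃] at key
  have e (z : ℂ) := congrArg (eval z) key
  simp only [eval_add, eval_mul, eval_C, eval_pow, eval_X, eval_sub] at e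
  have e0 := e 0
  have e1 := e 1
  have e2 := e (-1)
  refine ⟨?_, ?_, ?_⟩ <;> grind

theorem quartic_coeffs_of_unique_root (c₄ c₃ c₂ c₁ c₀ w : ℂ) (h₄ : c₄ ≠ 0)
    (h : ∀ z, c₄ * z ^ 4 + c₃ * z ^ 3 + c₂ * z ^ 2 + c₁ * z + c₀ = 0 → z = w) :
    c₃ = -4 * c₄ * w ∧ c₂ = 6 * c₄ * w ^ 2 ∧ c₁ = -4 * c₄ * w ^ 3 ∧ c₀ = c₄ * w ^ 4 := by
  have hd : (C c₄ * X ^ 4 + C c₃ * X ^ 3 + C c₂ * X ^ 2 + C c₁ * X + C c₀).natDegree = 4 := by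
    compute_degree!
  have hl : (C c₄ * X ^ 4 + C c₃ * X ^ 3 + C c₂ * X ^ 2 + C c₁ * X + C c₀).leadingCoeff = c₄ := by
    rw [leadingCoeff, hd]
    simp
  have key := eq_C_mul_X_sub_C_pow_of_unique_root
    (C c₄ * X ^ 4 + C c₃ * X ^ 3 + C c₂ * X ^ 2 + C c₁ * X + C c₀) w (by simpa using h)
  rw [hl, hd] at key
  have e (z : ℂ) := congrArg (eval z) key
  simp only [eval_add, eval_mul, eval_C, eval_pow, eval_X, eval_sub] at e
  have e0 := e 0
  have e1 := e 1
  have e2 := e (-1)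
  have e3 := e 2
  refine ⟨?_, ?_, ?_, ?_⟩ <;> grind

theorem cubic_system_false (r t : ℂ) (h₁ : r = 3 - 2 * t) (h₂ : t + 2 * r * t = 3)
    (h₃ : r * t ^ 2 = 1) (ht : t ≠ 1) : False := by
  grind

theorem double_pole_system_false (n t : ℂ) (h₁ : -2 * n * t + n + 3 * t = 3)
    (h₂ : n * t - 3 * t ^ 2 = -3) (h₃ : t ^ 3 = 1) (ht : t ≠ 1) : False := by
  grind

theorem quartic_system_false (n u v : ℂ) (h₁ : n * (u + 1) - 2 * u = 4)
    (h₂ : 2 * n * v - (u ^ 2 + 2 * v) = -6) (h₃ : -n * v - 2 * u * v = 4) (h₄ : v ^ 2 = 1)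
    (h : 1 + u + v ≠ 0) : False := by
  have : v = 1 ∨ v = -1 := by simpa using h₄
  grind

section ValueAtZero

variable {l a f₂ f₁ q₂ q₁ q₀ : ℂ}

/-- If `f₂ X ^ 2 + f₁ X` and `q₂ X ^ 2 + q₁ X + q₀` are the coprime numerator and denominator of
`R - a`, then `R` takes the value `a` at one nonzero point at most. -/
theorem exists_unique_root_candidate (hlead : q₂ = 0 → f₂ ≠ 0)
    (hcop : ∀ w, f₂ * w + f₁ = 0 → q₂ * w ^ 2 + q₁ * w + q₀ ≠ 0) :
    ∃ w, (∀ z, z ≠ 0 → f₂ * z + f₁ = 0 → z = w) ∧ (w ≠ 0 → f₁ = -f₂ * w ∧ f₂ ≠ 0) := by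
  by_cases h : f₂ = 0 ∨ f₁ = 0
  · by_cases h' : f₂ = 0 ∧ f₁ = 0
    · exfalso
      by_cases hq₂ : q₂ = 0
      · exact hlead hq₂ h'.1
      · obtain ⟨z, hz⟩ := IsAlgClosed.exists_root (C q₂ * X ^ 2 + C q₁ * X + C q₀)
          (by rw [degree_quadratic hq₂]; norm_num)
        exact hcop z (by simp [h'.1, h'.2]) (by simpa using hz)
    · exact ⟨0, by grind, by simp⟩
  · push Not at h
    exact ⟨-f₁ / f₂, fun z _ hz => by rw [eq_div_iff h.1]; linear_combination hz,
      fun _ => ⟨by field_simp [h.1], h.1⟩⟩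

theorem false_of_value_at_zero_of_const (hl : l ≠ 0) (ha : a ≠ 0) (hq₀ : q₀ ≠ 0) (hf₂ : f₂ ≠ 0)
    (hshare : ∀ w, w ≠ 0 → l * w * (2 * f₂ * q₀ * w + f₁ * q₀) = a * q₀ ^ 2 → f₂ * w + f₁ = 0) :
    False := by
  obtain ⟨w, hw, hw'⟩ := exists_unique_root_candidate (q₂ := 0) (q₁ := 0) (f₁ := f₁)
    (fun _ => hf₂) (fun _ _ => by simpa using hq₀)
  have ha' : a * q₀ ^ 2 ≠ 0 := by positivity
  obtain ⟨e₁, e₀⟩ := quadratic_coeffs_of_unique_root (2 * l * f₂ * q₀) (l * f₁ * q₀)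
    (-a * q₀ ^ 2) w (by simp [hl, hf₂, hq₀]) (by
      intro z hz
      have hz0 : z ≠ 0 := by
        rintro rfl
        exact ha' (by linear_combination -hz)
      exact hw z hz0 (hshare z hz0 (by linear_combination hz)))
  have hw0 : w ≠ 0 := by
    rintro rfl
    exact ha' (by linear_combination -e₀)
  obtain ⟨rfl, -⟩ := hw' hw0
  have : l * f₂ * q₀ * w ≠ 0 := by positivity
  exact this (by linear_combination (1 / 3) * e₁)

theorem false_of_value_at_zero_of_linear (hl : l ≠ 0) (ha : a ≠ 0) (hq₀ : q₀ ≠ 0) (hf₂ : f₂ ≠ 0)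
    (hq₁ : q₁ ≠ 0) (hcop : ∀ w, f₂ * w + f₁ = 0 → q₁ * w + q₀ ≠ 0)
    (hshare : ∀ w, w ≠ 0 → q₁ * w + q₀ ≠ 0 →
      l * w * (f₂ * q₁ * w ^ 2 + 2 * f₂ * q₀ * w + f₁ * q₀) = a * (q₁ * w + q₀) ^ 2 →
        f₂ * w + f₁ = 0) : False := by
  obtain ⟨w, hw, hw'⟩ := exists_unique_root_candidate (q₂ := 0) (q₁ := q₁) (q₀ := q₀)
    (fun _ => hf₂) (fun w h => by simpa using hcop w h)
  have ha' : a * q₀ ^ 2 ≠ 0 := by positivity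
  obtain ⟨e₂, e₁, e₀⟩ := cubic_coeffs_of_unique_root (l * f₂ * q₁)
    (2 * l * f₂ * q₀ - a * q₁ ^ 2) (l * f₁ * q₀ - 2 * a * q₁ * q₀) (-a * q₀ ^ 2) w
    (by positivity) (by
      intro z hz
      have hz0 : z ≠ 0 := by
        rintro rfl
        exact ha' (by linear_combination -hz)
      have hQ : q₁ * z + q₀ ≠ 0 := by
        intro hQ
        refine hcop z ?_ hQ
        have h : l * z * q₀ * (f₂ * z + f₁) = 0 := by
          linear_combination hz - l * f₂ * z ^ 2 * hQ + a * (q₁ * z + q₀) * hQ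
        simpa [hl, hz0, hq₀] using h
      exact hw z hz0 (hshare z hz0 hQ (by linear_combination hz)))
  have hw0 : w ≠ 0 := by
    rintro rfl
    exact ha' (by linear_combination -e₀)
  obtain ⟨rfl, -⟩ := hw' hw0
  obtain ⟨t, rfl⟩ : ∃ t, q₀ = -q₁ * w * t := ⟨-q₀ / (q₁ * w), by field_simp⟩
  obtain ⟨r, hr⟩ : ∃ r, a * q₁ = l * f₂ * w * r := ⟨a * q₁ / (l * f₂ * w), by field_simp⟩
  have hK : l * f₂ * q₁ * w ≠ 0 := by positivity
  refine cubic_system_false r t ?_ ?_ ?_ ?_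
  · apply mul_left_cancel₀ hK
    linear_combination -e₂ - q₁ * hr
  · apply mul_left_cancel₀ (mul_ne_zero hK hw0)
    linear_combination e₁ - 2 * q₁ * w * t * hr
  · apply mul_left_cancel₀ (mul_ne_zero hK (pow_ne_zero 2 hw0))
    linear_combination -e₀ - q₁ * w ^ 2 * t ^ 2 * hr
  · rintro rfl
    exact hcop w (by ring) (by ring)

theorem false_of_value_at_zero_of_double_pole (s : ℂ) (hl : l ≠ 0) (ha : a ≠ 0) (hq₂ : q₂ ≠ 0)
    (hs : s ≠ 0) (hcop : ∀ w, f₂ * w + f₁ = 0 → q₂ * (w - s) ^ 2 ≠ 0)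
    (hshare : ∀ w, w ≠ 0 → q₂ * (w - s) ^ 2 ≠ 0 →
      l * w * (q₂ * (w - s) * (-(2 * f₂ * s + f₁) * w - f₁ * s)) = a * (q₂ * (w - s) ^ 2) ^ 2 →
        f₂ * w + f₁ = 0) : False := by
  obtain ⟨w, hw, hw'⟩ := exists_unique_root_candidate (q₂ := q₂) (q₁ := -2 * q₂ * s)
    (q₀ := q₂ * s ^ 2) (f₂ := f₂) (f₁ := f₁)
    (fun h => absurd h hq₂) (fun w h => by convert hcop w h using 1; ring)
  obtain ⟨m, hm⟩ : ∃ m, l * f₂ = a * q₂ * m := ⟨l * f₂ / (a * q₂), by field_simp⟩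
  obtain ⟨g, hg⟩ : ∃ g, l * f₁ = a * q₂ * g := ⟨l * f₁ / (a * q₂), by field_simp⟩
  obtain ⟨e₂, e₁, e₀⟩ := cubic_coeffs_of_unique_root (-1)
    (-2 * m * s - g + 3 * s) (-g * s - 3 * s ^ 2) (s ^ 3) w
    (by norm_num) (by
      intro z hz
      have hz0 : z ≠ 0 := by
        rintro rfl
        exact pow_ne_zero 3 hs (by linear_combination hz)
      have hzs : z ≠ s := by
        rintro rfl
        refine hcop z ?_ (by ring)
        have h : l * z ^ 2 * (f₂ * z + f₁) = 0 := by
          linear_combination -a * q₂ / 2 * hz + z ^ 3 * hm + z ^ 2 * hg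
        simpa [hl, hz0] using h
      have hzs' : z - s ≠ 0 := sub_ne_zero.2 hzs
      refine hw z hz0 (hshare z hz0 (by positivity) ?_)
      linear_combination a * q₂ ^ 2 * (z - s) * hz
        - 2 * z ^ 2 * s * q₂ * (z - s) * hm - z * q₂ * (z - s) * (z + s) * hg)
  have hw0 : w ≠ 0 := by
    rintro rfl
    exact pow_ne_zero 3 hs (by linear_combination e₀)
  obtain ⟨rfl, hf₂⟩ := hw' hw0
  obtain rfl : g = -m * w := by
    apply mul_left_cancel₀ (mul_ne_zero ha hq₂)
    linear_combination -hg - w * hm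
  obtain ⟨t, rfl⟩ : ∃ t, s = w * t := ⟨s / w, by field_simp⟩
  refine double_pole_system_false m t ?_ ?_ ?_ ?_
  · apply mul_left_cancel₀ hw0
    linear_combination e₂
  · apply mul_left_cancel₀ (pow_ne_zero 2 hw0)
    linear_combination e₁
  · apply mul_left_cancel₀ (pow_ne_zero 3 hw0)
    linear_combination e₀
  · rintro rfl
    exact hcop w (by ring) (by ring)

theorem false_of_value_at_zero_of_quadratic (hl : l ≠ 0) (ha : a ≠ 0) (hq₀ : q₀ ≠ 0)
    (hq₂ : q₂ ≠ 0) (hdisc : q₁ ^ 2 ≠ 4 * q₂ * q₀)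
    (hcop : ∀ w, f₂ * w + f₁ = 0 → q₂ * w ^ 2 + q₁ * w + q₀ ≠ 0)
    (hshare : ∀ w, w ≠ 0 → q₂ * w ^ 2 + q₁ * w + q₀ ≠ 0 →
      l * w * ((f₂ * q₁ - f₁ * q₂) * w ^ 2 + 2 * f₂ * q₀ * w + f₁ * q₀)
        = a * (q₂ * w ^ 2 + q₁ * w + q₀) ^ 2 → f₂ * w + f₁ = 0) : False := by
  obtain ⟨w, hw, hw'⟩ := exists_unique_root_candidate (fun h => absurd h hq₂) hcop
  have ha' : a * q₀ ^ 2 ≠ 0 := by positivity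
  obtain ⟨e₃, e₂, e₁, e₀⟩ := quartic_coeffs_of_unique_root (-a * q₂ ^ 2)
    (l * (f₂ * q₁ - f₁ * q₂) - 2 * a * q₂ * q₁) (2 * l * f₂ * q₀ - a * (q₁ ^ 2 + 2 * q₂ * q₀))
    (l * f₁ * q₀ - 2 * a * q₁ * q₀) (-a * q₀ ^ 2) w
    (by simp [ha, hq₂]) (by
      intro z hz
      have hz0 : z ≠ 0 := by
        rintro rfl
        exact ha' (by linear_combination -hz)
      have hQ : q₂ * z ^ 2 + q₁ * z + q₀ ≠ 0 := by
        intro hQ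
        have h : l * z ^ 2 * ((f₂ * z + f₁) * (2 * q₂ * z + q₁)) = 0 := by
          linear_combination -hz + (l * z * (2 * f₂ * z + f₁)
            - a * (q₂ * z ^ 2 + q₁ * z + q₀)) * hQ
        have h' : (f₂ * z + f₁) * (2 * q₂ * z + q₁) = 0 := by simpa [hl, hz0] using h
        rcases mul_eq_zero.1 h' with h' | h'
        · exact hcop z h' hQ
        · exact hdisc (by linear_combination (2 * q₂ * z + q₁) * h' - 4 * q₂ * hQ)
      exact hw z hz0 (hshare z hz0 hQ (by linear_combination hz)))
  have hw0 : w ≠ 0 := by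
    rintro rfl
    exact ha' (by linear_combination -e₀)
  obtain ⟨rfl, -⟩ := hw' hw0
  obtain ⟨u, rfl⟩ : ∃ u, q₁ = q₂ * w * u := ⟨q₁ / (q₂ * w), by field_simp⟩
  obtain ⟨v, rfl⟩ : ∃ v, q₀ = q₂ * w ^ 2 * v := ⟨q₀ / (q₂ * w ^ 2), by field_simp⟩
  obtain ⟨n, hn⟩ : ∃ n, l * f₂ = a * q₂ * n := ⟨l * f₂ / (a * q₂), by field_simp⟩
  have hK : a * q₂ ^ 2 * w ≠ 0 := by positivity
  refine quartic_system_false n u v ?_ ?_ ?_ ?_ ?_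
  · apply mul_left_cancel₀ hK
    linear_combination e₃ - q₂ * w * (u + 1) * hn
  · apply mul_left_cancel₀ (mul_ne_zero hK hw0)
    linear_combination e₂ - 2 * q₂ * w ^ 2 * v * hn
  · apply mul_left_cancel₀ (mul_ne_zero hK (pow_ne_zero 2 hw0))
    linear_combination e₁ + q₂ * w ^ 3 * v * hn
  · apply mul_left_cancel₀ (mul_ne_zero hK (pow_ne_zero 3 hw0))
    linear_combination -e₀
  · intro h
    exact hcop w (by ring) (by linear_combination q₂ * w ^ 2 * h)

end ValueAtZero

section Scalar

variable {l a p₂ p₁ p₀ q₂ q₁ q₀ : ℂ}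

theorem quadratic_value_at_zero_ne (hl : l ≠ 0) (ha : a ≠ 0) (htop : q₂ = 0 → p₂ ≠ 0)
    (hcop : ∀ w, p₂ * w ^ 2 + p₁ * w + p₀ = 0 → q₂ * w ^ 2 + q₁ * w + q₀ ≠ 0)
    (hshare : ∀ w, w ≠ 0 → q₂ * w ^ 2 + q₁ * w + q₀ ≠ 0 →
      l * w * ((p₂ * q₁ - p₁ * q₂) * w ^ 2 + 2 * (p₂ * q₀ - p₀ * q₂) * w + (p₁ * q₀ - p₀ * q₁))
        = a * (q₂ * w ^ 2 + q₁ * w + q₀) ^ 2 →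
      p₂ * w ^ 2 + p₁ * w + p₀ = a * (q₂ * w ^ 2 + q₁ * w + q₀)) :
    p₀ ≠ a * q₀ := by
  rintro rfl
  have hq₀ : q₀ ≠ 0 := fun h => hcop 0 (by simp [h]) (by simp [h])
  obtain ⟨f₂, rfl⟩ : ∃ f, p₂ = f + a * q₂ := ⟨p₂ - a * q₂, by ring⟩
  obtain ⟨f₁, rfl⟩ : ∃ f, p₁ = f + a * q₁ := ⟨p₁ - a * q₁, by ring⟩
  have hcop' (w : ℂ) (h : f₂ * w + f₁ = 0) : q₂ * w ^ 2 + q₁ * w + q₀ ≠ 0 := fun hQ =>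
    hcop w (by linear_combination w * h + a * hQ) hQ
  have hshare' (w : ℂ) (hw : w ≠ 0) (hQ : q₂ * w ^ 2 + q₁ * w + q₀ ≠ 0)
      (h : l * w * ((f₂ * q₁ - f₁ * q₂) * w ^ 2 + 2 * f₂ * q₀ * w + f₁ * q₀)
        = a * (q₂ * w ^ 2 + q₁ * w + q₀) ^ 2) : f₂ * w + f₁ = 0 := by
    apply mul_left_cancel₀ hw
    linear_combination hshare w hw hQ (by linear_combination h)
  by_cases hq₂ : q₂ = 0
  · subst hq₂
    have hf₂ : f₂ ≠ 0 := by simpa using htop rfl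
    by_cases hq₁ : q₁ = 0
    · subst hq₁
      exact false_of_value_at_zero_of_const (f₁ := f₁) hl ha hq₀ hf₂ fun w hw h =>
        hshare' w hw (by simpa using hq₀) (by linear_combination h)
    · exact false_of_value_at_zero_of_linear hl ha hq₀ hf₂ hq₁ (f₁ := f₁)
        (fun w h => by simpa using hcop' w h)
        fun w hw hQ h => hshare' w hw (by simpa using hQ) (by linear_combination h)
  · by_cases hdisc : q₁ ^ 2 = 4 * q₂ * q₀
    · obtain ⟨s, rfl⟩ : ∃ s, q₁ = -2 * q₂ * s := ⟨-q₁ / (2 * q₂), by field_simp⟩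
      obtain rfl : q₀ = q₂ * s ^ 2 := by
        apply mul_left_cancel₀ hq₂
        linear_combination -(1 / 4) * hdisc
      have hQ (w : ℂ) : q₂ * w ^ 2 + -2 * q₂ * s * w + q₂ * s ^ 2 = q₂ * (w - s) ^ 2 := by ring
      refine false_of_value_at_zero_of_double_pole s hl ha hq₂ (by rintro rfl; simp at hq₀)
        (f₂ := f₂) (f₁ := f₁) (fun w h => hQ w ▸ hcop' w h) fun w hw hQw h =>
          hshare' w hw (hQ w ▸ hQw) ?_
      linear_combination h
    · exact false_of_value_at_zero_of_quadratic hl ha hq₀ hq₂ hdisc hcop' hshare'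

theorem linear_value_at_zero_ne (hl : l ≠ 0) (ha : a ≠ 0) (htop : q₁ = 0 → p₁ ≠ 0)
    (hcop : ∀ w, p₁ * w + p₀ = 0 → q₁ * w + q₀ ≠ 0)
    (hshare : ∀ w, w ≠ 0 → q₁ * w + q₀ ≠ 0 →
      l * w * (p₁ * q₀ - p₀ * q₁) = a * (q₁ * w + q₀) ^ 2 → p₁ * w + p₀ = a * (q₁ * w + q₀)) :
    p₀ ≠ a * q₀ := by
  rintro rfl
  have hq₀ : q₀ ≠ 0 := fun h => hcop 0 (by simp [h]) (by simp [h])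
  obtain ⟨f, rfl⟩ : ∃ f, p₁ = f + a * q₁ := ⟨p₁ - a * q₁, by ring⟩
  have hf : f ≠ 0 := by
    rintro rfl
    by_cases hq₁ : q₁ = 0
    · exact htop hq₁ (by simp [hq₁])
    · exact hcop (-q₀ / q₁) (by field_simp; ring) (by field_simp; ring)
  have hno (w : ℂ) (h : l * w * (f * q₀) = a * (q₁ * w + q₀) ^ 2) : False := by
    have hw : w ≠ 0 := by
      rintro rfl
      have : a * q₀ ^ 2 ≠ 0 := by positivity
      exact this (by linear_combination -h)
    refine mul_ne_zero hf hw ?_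
    have hQ : q₁ * w + q₀ ≠ 0 := by
      intro hQ
      rw [hQ] at h
      simp [hl, hw, hf, hq₀] at h
    linear_combination hshare w hw hQ (by linear_combination h)
  by_cases hq₁ : q₁ = 0
  · exact hno (a * q₀ / (l * f)) (by subst hq₁; field_simp; ring)
  · obtain ⟨z, hz⟩ := IsAlgClosed.exists_root
      (C (a * q₁ ^ 2) * X ^ 2 + C (2 * a * q₁ * q₀ - l * f * q₀) * X + C (a * q₀ ^ 2))
      (by rw [degree_quadratic (by positivity)]; norm_num)
    have hz' : a * q₁ ^ 2 * z ^ 2 + (2 * a * q₁ * q₀ - l * f * q₀) * z + a * q₀ ^ 2 = 0 := by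
      simpa using hz
    exact hno z (by linear_combination -hz')

theorem quadratic_value_at_infinity_ne (hl : l ≠ 0) (ha : a ≠ 0) (htop : q₂ = 0 → p₂ ≠ 0)
    (hcop : ∀ w, p₂ * w ^ 2 + p₁ * w + p₀ = 0 → q₂ * w ^ 2 + q₁ * w + q₀ ≠ 0)
    (hshare : ∀ w, w ≠ 0 → q₂ * w ^ 2 + q₁ * w + q₀ ≠ 0 →
      l * w * ((p₂ * q₁ - p₁ * q₂) * w ^ 2 + 2 * (p₂ * q₀ - p₀ * q₂) * w + (p₁ * q₀ - p₀ * q₁))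
        = a * (q₂ * w ^ 2 + q₁ * w + q₀) ^ 2 →
      p₂ * w ^ 2 + p₁ * w + p₀ = a * (q₂ * w ^ 2 + q₁ * w + q₀)) :
    p₂ ≠ a * q₂ := by
  have key (x y z w : ℂ) (hw : w ≠ 0) :
      x * w⁻¹ ^ 2 + y * w⁻¹ + z = w⁻¹ ^ 2 * (z * w ^ 2 + y * w + x) := by
    field_simp
    ring
  refine quadratic_value_at_zero_ne (l := -l) (p₂ := p₀) (p₁ := p₁) (p₀ := p₂)
    (q₂ := q₀) (q₁ := q₁) (q₀ := q₂) (neg_ne_zero.2 hl) ha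
    (fun h h' => hcop 0 (by simp [h']) (by simp [h])) (fun w h => ?_) (fun w hw hQ h => ?_)
  · by_cases hw : w = 0
    · subst hw
      intro h'
      exact htop (by simpa using h') (by simpa using h)
    · intro h'
      exact hcop w⁻¹ (by rw [key _ _ _ _ hw, h, mul_zero]) (by rw [key _ _ _ _ hw, h', mul_zero])
  · have hw' : w⁻¹ ^ 2 ≠ 0 := by positivity
    have := hshare w⁻¹ (inv_ne_zero hw) (by rw [key _ _ _ _ hw]; exact mul_ne_zero hw' hQ) (by
      rw [key _ _ _ _ hw, key _ _ _ _ hw, mul_pow, mul_left_comm a, ← h]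
      field_simp
      ring)
    rw [key _ _ _ _ hw, key _ _ _ _ hw] at this
    apply mul_left_cancel₀ hw'
    linear_combination this

theorem linear_value_at_infinity_ne (hl : l ≠ 0) (ha : a ≠ 0) (htop : q₁ = 0 → p₁ ≠ 0)
    (hcop : ∀ w, p₁ * w + p₀ = 0 → q₁ * w + q₀ ≠ 0)
    (hshare : ∀ w, w ≠ 0 → q₁ * w + q₀ ≠ 0 →
      l * w * (p₁ * q₀ - p₀ * q₁) = a * (q₁ * w + q₀) ^ 2 → p₁ * w + p₀ = a * (q₁ * w + q₀)) :
    p₁ ≠ a * q₁ := by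
  have key (x y w : ℂ) (hw : w ≠ 0) : x * w⁻¹ + y = w⁻¹ * (y * w + x) := by
    field_simp
    ring
  refine linear_value_at_zero_ne (l := -l) (p₁ := p₀) (p₀ := p₁) (q₁ := q₀) (q₀ := q₁)
    (neg_ne_zero.2 hl) ha
    (fun h h' => hcop 0 (by simp [h']) (by simp [h])) (fun w h => ?_) (fun w hw hQ h => ?_)
  · by_cases hw : w = 0
    · subst hw
      intro h'
      exact htop (by simpa using h') (by simpa using h)
    · intro h'
      exact hcop w⁻¹ (by rw [key _ _ _ hw, h, mul_zero]) (by rw [key _ _ _ hw, h', mul_zero])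
  · have hw' : w⁻¹ ≠ 0 := inv_ne_zero hw
    have := hshare w⁻¹ hw' (by rw [key _ _ _ hw]; exact mul_ne_zero hw' hQ) (by
      rw [key _ _ _ hw, mul_pow, mul_left_comm a, ← h]
      field_simp
      ring)
    rw [key _ _ _ hw, key _ _ _ hw] at this
    apply mul_left_cancel₀ hw'
    linear_combination this

end Scalar
theorem dvd_of_separable_of_roots {F H : ℂ[X]} (hF : F.Separable)
    (hroots : ∀ x, F.eval x = 0 → H.eval x = 0) : F ∣ H := by
  rcases eq_or_ne H 0 with rfl | hH
  · simp
  refine (IsAlgClosed.splits F).dvd_of_roots_le_roots hF.ne_zero ?_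
  rw [Multiset.le_iff_subset (nodup_roots hF)]
  intro x hx
  exact (mem_roots hH).2 (hroots x (mem_roots'.1 hx).2)

section Sharing

variable {l a b : ℂ} {P Q : ℂ[X]} {d : ℕ}

theorem eval_ne_zero_of_isCoprime (hPQ : IsCoprime P Q) (w : ℂ) (hP : P.eval w = 0) :
    Q.eval w ≠ 0 := by
  obtain ⟨u, v, huv⟩ := hPQ
  intro hQ
  simpa [hP, hQ] using congrArg (eval w) huv

theorem eval_ne_zero_of_value (hPQ : IsCoprime P Q) {w : ℂ} (h : (P - C a * Q).eval w = 0) :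
    Q.eval w ≠ 0 := by
  intro hQ
  exact eval_ne_zero_of_isCoprime hPQ w (by simpa [hQ] using h) hQ

theorem separable_sub_of_share (hPQ : IsCoprime P Q) (ha : a ≠ 0)
    (hzero : (P - C a * Q).eval 0 ≠ 0)
    (hshare : ∀ w : ℂ, w ≠ 0 → Q.eval w ≠ 0 →
      (P.eval w = a * Q.eval w ↔
        l * w * (derivative P * Q - P * derivative Q).eval w = a * (Q.eval w) ^ 2)) :
    (P - C a * Q).Separable := by
  rw [separable_def, isCoprime_iff_aeval_ne_zero_of_isAlgClosed ℂ ℂ]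
  intro x
  simp only [coe_aeval_eq_eval]
  by_contra! h
  obtain ⟨h₁, h₂⟩ := h
  have hx : x ≠ 0 := by
    rintro rfl
    exact hzero h₁
  have hQ := eval_ne_zero_of_value hPQ h₁
  simp only [eval_sub, eval_mul, eval_C, derivative_sub, derivative_C_mul] at h₁ h₂
  have := (hshare x hx hQ).1 (by linear_combination h₁)
  simp only [eval_sub, eval_mul] at this
  refine mul_ne_zero ha (pow_ne_zero 2 hQ) ?_
  linear_combination -this + l * x * Q.eval x * h₂ - l * x * (derivative Q).eval x * h₁

theorem natDegree_wronskian_le (hP : P.natDegree ≤ d) (hQ : Q.natDegree ≤ d) :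
    (derivative P * Q - P * derivative Q).natDegree ≤ d - 1 + d := by
  have h₁ := (natDegree_derivative_le P).trans (Nat.sub_le_sub_right hP 1)
  have h₂ := (natDegree_derivative_le Q).trans (Nat.sub_le_sub_right hQ 1)
  refine (natDegree_sub_le _ _).trans (max_le (natDegree_mul_le_of_le h₁ hQ) ?_)
  rw [add_comm]
  exact natDegree_mul_le_of_le hP h₂

theorem coeff_X_mul_wronskian (hP : P.natDegree ≤ d) (hQ : Q.natDegree ≤ d) (hd : 1 ≤ d) :
    (X * (derivative P * Q - P * derivative Q)).coeff (d + d) = 0 := by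
  have h₁ := (natDegree_derivative_le P).trans (Nat.sub_le_sub_right hP 1)
  have h₂ := (natDegree_derivative_le Q).trans (Nat.sub_le_sub_right hQ 1)
  obtain ⟨k, rfl⟩ := Nat.exists_eq_add_of_le' hd
  rw [Nat.add_sub_cancel] at h₁ h₂
  have e₁ := coeff_mul_add_eq_of_natDegree_le h₁ hQ
  have e₂ := coeff_mul_add_eq_of_natDegree_le hP h₂
  rw [← add_assoc] at e₁ ⊢
  rw [show k + 1 + k = k + k + 1 by ring] at e₂
  rw [coeff_X_mul, coeff_sub, show k + 1 + k = k + k + 1 by ring, e₂,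
    show k + k + 1 = k + (k + 1) by ring, ← add_assoc, e₁, coeff_derivative, coeff_derivative]
  ring

/-- If `P Q - l X W = c (P - a Q) (P - b Q)` with `W` the Wronskian and `c ≠ 0`, then
`Q - c (P - b Q)` has a root at which `R = P / Q` takes the value `a`. -/
theorem mul_sub_eq_one_of_share (hPQ : IsCoprime P Q) (hP : P.natDegree ≤ d)
    (hQ : Q.natDegree ≤ d) (hd : 1 ≤ d) (ha : a ≠ 0) {c : ℂ} (hc : c ≠ 0)
    (hH : P * Q - C l * X * (derivative P * Q - P * derivative Q)
      = C c * ((P - C a * Q) * (P - C b * Q)))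
    (hbtop : (P - C b * Q).coeff d ≠ 0)
    (hshare : ∀ w : ℂ, w ≠ 0 → Q.eval w ≠ 0 →
      (P.eval w = a * Q.eval w ↔
        l * w * (derivative P * Q - P * derivative Q).eval w = a * (Q.eval w) ^ 2)) :
    c * (a - b) = 1 := by
  have hG : C l * (X * (derivative P * Q - P * derivative Q)) - C a * (Q * Q)
      = (P - C a * Q) * (Q - C c * (P - C b * Q)) := by
    linear_combination -hH
  have hF (e : ℂ) : (P - C e * Q).natDegree ≤ d :=
    (natDegree_sub_le _ _).trans (max_le hP ((natDegree_C_mul_le _ _).trans hQ))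
  have hKd : (Q - C c * (P - C b * Q)).natDegree ≤ d :=
    (natDegree_sub_le _ _).trans (max_le hQ ((natDegree_C_mul_le _ _).trans (hF b)))
  obtain ⟨x, hx⟩ : ∃ x, (Q - C c * (P - C b * Q)).eval x = 0 := by
    refine IsAlgClosed.exists_root _ fun h => ?_
    have hKtop : (Q - C c * (P - C b * Q)).coeff d = 0 :=
      coeff_eq_zero_of_natDegree_lt ((natDegree_eq_of_degree_eq_some h).trans_lt hd)
    have hQtop : Q.coeff d = 0 := by
      have := congrArg (coeff · (d + d)) hG
      simp only [coeff_sub (C l * _), coeff_C_mul, coeff_X_mul_wronskian hP hQ hd,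
        coeff_mul_add_eq_of_natDegree_le hQ hQ, coeff_mul_add_eq_of_natDegree_le (hF a) hKd,
        hKtop] at this
      simpa [ha] using this
    rw [coeff_sub, hQtop, coeff_C_mul, zero_sub, neg_eq_zero] at hKtop
    exact mul_ne_zero hc hbtop hKtop
  have hGx := congrArg (eval x) hG
  rw [eval_mul (p := P - _), hx, mul_zero] at hGx
  rw [eval_sub, eval_mul, eval_C, sub_eq_zero] at hx
  have hQx : Q.eval x ≠ 0 := by
    intro h
    refine eval_ne_zero_of_value (a := b) hPQ ?_ h
    simpa [hc, h] using hx.symm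
  have hx0 : x ≠ 0 := by
    rintro rfl
    simp [ha, hQx] at hGx
  have hPx := (hshare x hx0 hQx).2 (by
    simp only [eval_sub (p := C l * _), eval_mul (p := C _), eval_mul (p := X),
      eval_mul (p := Q), eval_C, eval_X] at hGx
    linear_combination hGx)
  simp only [eval_sub, eval_mul, eval_C, hPx] at hx
  apply mul_right_cancel₀ hQx
  linear_combination -hx

theorem eq_of_share_of_generic (hPQ : IsCoprime P Q) (hP : P.natDegree ≤ d)
    (hQ : Q.natDegree ≤ d) (hd : 1 ≤ d) (ha : a ≠ 0) (hb : b ≠ 0) (hab : a ≠ b)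
    (hazero : (P - C a * Q).eval 0 ≠ 0) (hatop : (P - C a * Q).coeff d ≠ 0)
    (hbzero : (P - C b * Q).eval 0 ≠ 0) (hbtop : (P - C b * Q).coeff d ≠ 0)
    (hsharea : ∀ w : ℂ, w ≠ 0 → Q.eval w ≠ 0 →
      (P.eval w = a * Q.eval w ↔
        l * w * (derivative P * Q - P * derivative Q).eval w = a * (Q.eval w) ^ 2))
    (hshareb : ∀ w : ℂ, w ≠ 0 → Q.eval w ≠ 0 →
      (P.eval w = b * Q.eval w ↔
        l * w * (derivative P * Q - P * derivative Q).eval w = b * (Q.eval w) ^ 2)) :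
    P * Q = C l * X * (derivative P * Q - P * derivative Q) := by
  have hF {e : ℂ} (he : (P - C e * Q).coeff d ≠ 0) : (P - C e * Q).natDegree = d :=
    natDegree_eq_of_le_of_coeff_ne_zero
      ((natDegree_sub_le _ _).trans (max_le hP ((natDegree_C_mul_le _ _).trans hQ))) he
  have hcop : IsCoprime (P - C a * Q) (P - C b * Q) := by
    rw [isCoprime_iff_aeval_ne_zero_of_isAlgClosed ℂ ℂ]
    intro x
    simp only [coe_aeval_eq_eval]
    by_contra! h
    refine mul_ne_zero (sub_ne_zero.2 hab) (eval_ne_zero_of_value hPQ h.1) ?_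
    simp only [eval_sub, eval_mul, eval_C] at h
    linear_combination h.2 - h.1
  have hroot {e : ℂ} (hzero : (P - C e * Q).eval 0 ≠ 0)
      (hshare : ∀ w : ℂ, w ≠ 0 → Q.eval w ≠ 0 →
        (P.eval w = e * Q.eval w ↔
          l * w * (derivative P * Q - P * derivative Q).eval w = e * (Q.eval w) ^ 2))
      (x : ℂ) (hx : (P - C e * Q).eval x = 0) :
      (P * Q - C l * X * (derivative P * Q - P * derivative Q)).eval x = 0 := by
    have hx0 : x ≠ 0 := by
      rintro rfl
      exact hzero hx
    have hQx := eval_ne_zero_of_value hPQ hx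
    simp only [eval_sub (p := P), eval_mul, eval_C, sub_eq_zero] at hx
    rw [eval_sub, eval_mul, eval_mul, eval_mul, eval_C, eval_X, (hshare x hx0 hQx).1 hx, hx]
    ring
  obtain ⟨K, hK⟩ : (P - C a * Q) * (P - C b * Q) ∣
      P * Q - C l * X * (derivative P * Q - P * derivative Q) := by
    refine dvd_of_separable_of_roots
      ((separable_sub_of_share hPQ ha hazero hsharea).mul
        (separable_sub_of_share hPQ hb hbzero hshareb) hcop) fun x hx => ?_
    rw [eval_mul, mul_eq_zero] at hx
    exact hx.elim (hroot hazero hsharea x) (hroot hbzero hshareb x)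
  have ha0 : P - C a * Q ≠ 0 := fun h => hazero (by simp [h])
  have hb0 : P - C b * Q ≠ 0 := fun h => hbzero (by simp [h])
  have hKdeg : K.natDegree = 0 := by
    by_cases hK0 : K = 0
    · simp [hK0]
    have h₁ : (P * Q - C l * X * (derivative P * Q - P * derivative Q)).natDegree ≤ d + d := by
      refine (natDegree_sub_le _ _).trans (max_le (natDegree_mul_le_of_le hP hQ) ?_)
      refine (natDegree_mul_le_of_le ((natDegree_C_mul_le l X).trans natDegree_X_le)
        (natDegree_wronskian_le hP hQ)).trans ?_
      omega
    rw [hK, natDegree_mul (mul_ne_zero ha0 hb0) hK0, natDegree_mul ha0 hb0, hF hatop, hF hbtop]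
      at h₁
    omega
  rw [eq_C_of_natDegree_eq_zero hKdeg] at hK
  by_cases hc : K.coeff 0 = 0
  · rw [hc, C_0, mul_zero, sub_eq_zero] at hK
    exact hK
  · exfalso
    have h₁ := mul_sub_eq_one_of_share hPQ hP hQ hd ha hc (by rw [hK]; ring) hbtop hsharea
    have h₂ := mul_sub_eq_one_of_share hPQ hP hQ hd hb hc (by rw [hK]; ring) hatop hshareb
    exact two_ne_zero (α := ℂ) (by linear_combination -h₁ - h₂)

theorem value_at_zero_and_infinity_ne (hl : l ≠ 0) (hPQ : IsCoprime P Q)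
    (hd : d = max P.natDegree Q.natDegree) (hd1 : 1 ≤ d) (hd2 : d ≤ 2) (ha : a ≠ 0)
    (hshare : ∀ w : ℂ, w ≠ 0 → Q.eval w ≠ 0 →
      (P.eval w = a * Q.eval w ↔
        l * w * (derivative P * Q - P * derivative Q).eval w = a * (Q.eval w) ^ 2)) :
    (P - C a * Q).eval 0 ≠ 0 ∧ (P - C a * Q).coeff d ≠ 0 := by
  have hP : P.natDegree ≤ d := hd ▸ le_max_left _ _
  have hQ : Q.natDegree ≤ d := hd ▸ le_max_right _ _
  have htop (h : Q.coeff d = 0) : P.coeff d ≠ 0 := by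
    intro h'
    rcases le_total P.natDegree Q.natDegree with hle | hle
    · rw [max_eq_right hle] at hd
      rw [hd, coeff_natDegree, leadingCoeff_eq_zero] at h
      simp [h] at hd
      omega
    · rw [max_eq_left hle] at hd
      rw [hd, coeff_natDegree, leadingCoeff_eq_zero] at h'
      simp [h'] at hd
      omega
  simp only [← coeff_zero_eq_eval_zero, coeff_sub, coeff_C_mul, sub_ne_zero]
  have hcop := eval_ne_zero_of_isCoprime hPQ
  obtain rfl | rfl : d = 1 ∨ d = 2 := by omega
  · have hf {f : ℂ[X]} (h : f.natDegree ≤ 1) (w : ℂ) :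
        f.eval w = f.coeff 1 * w + f.coeff 0 := by
      rw [eval_eq_sum_range' (Nat.lt_succ_of_le h)]
      simp [Finset.sum_range_succ]
      ring
    have hf' {f : ℂ[X]} (h : f.natDegree ≤ 1) (w : ℂ) :
        (derivative f).eval w = f.coeff 1 := by
      rw [derivative_eval, sum_over_range' _ (by simp) _ (Nat.lt_succ_of_le h)]
      simp [Finset.sum_range_succ]
    simp only [hf hP, hf hQ] at hcop
    simp only [eval_sub, eval_mul, hf hP, hf hQ, hf' hP, hf' hQ] at hshare
    have hshare' := fun w hw hQw h => (hshare w hw hQw).2 h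
    constructor
    · refine linear_value_at_zero_ne hl ha htop hcop fun w hw hQw h => hshare' w hw hQw ?_
      linear_combination h
    · refine linear_value_at_infinity_ne hl ha htop hcop fun w hw hQw h => hshare' w hw hQw ?_
      linear_combination h
  · have hf {f : ℂ[X]} (h : f.natDegree ≤ 2) (w : ℂ) :
        f.eval w = f.coeff 2 * w ^ 2 + f.coeff 1 * w + f.coeff 0 := by
      rw [eval_eq_sum_range' (Nat.lt_succ_of_le h)]
      simp [Finset.sum_range_succ]
      ring
    have hf' {f : ℂ[X]} (h : f.natDegree ≤ 2) (w : ℂ) :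
        (derivative f).eval w = 2 * f.coeff 2 * w + f.coeff 1 := by
      rw [derivative_eval, sum_over_range' _ (by simp) _ (Nat.lt_succ_of_le h)]
      simp [Finset.sum_range_succ]
      ring
    simp only [hf hP, hf hQ] at hcop
    simp only [eval_sub, eval_mul, hf hP, hf hQ, hf' hP, hf' hQ] at hshare
    have hshare' := fun w hw hQw h => (hshare w hw hQw).2 h
    constructor
    · refine quadratic_value_at_zero_ne hl ha htop hcop fun w hw hQw h => hshare' w hw hQw ?_
      linear_combination h
    · refine quadratic_value_at_infinity_ne hl ha htop hcop fun w hw hQw h => hshare' w hw hQw ?_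
      linear_combination h

end Sharing

/-- If a non-constant rational function `R = P/Q` of degree `d ≤ 2` and `∂_z R` share
two distinct finite non-zero values in `ℂ*`, then `R ≡ ∂_z R`. -/
theorem R_dzR_deg_le_two_share_two_nonzero_values
    (l : ℂ) (hl : l ≠ 0)
    (P Q : ℂ[X]) (hPQ : IsCoprime P Q) (hQ : Q ≠ 0)
    (d : ℕ) (hd : d = max P.natDegree Q.natDegree) (hd1 : 1 ≤ d) (hd2 : d ≤ 2)
    (a b : ℂ) (ha : a ≠ 0) (hb : b ≠ 0) (hab : a ≠ b)
    (hsharea : ∀ w : ℂ, w ≠ 0 → Q.eval w ≠ 0 →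
      (P.eval w = a * Q.eval w ↔
        l * w * (derivative P * Q - P * derivative Q).eval w = a * (Q.eval w) ^ 2))
    (hshareb : ∀ w : ℂ, w ≠ 0 → Q.eval w ≠ 0 →
      (P.eval w = b * Q.eval w ↔
        l * w * (derivative P * Q - P * derivative Q).eval w = b * (Q.eval w) ^ 2)) :
    P * Q = C l * X * (derivative P * Q - P * derivative Q) := by
  obtain ⟨hazero, hatop⟩ := value_at_zero_and_infinity_ne hl hPQ hd hd1 hd2 ha hsharea
  obtain ⟨hbzero, hbtop⟩ := value_at_zero_and_infinity_ne hl hPQ hd hd1 hd2 hb hshareb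
  exact eq_of_share_of_generic hPQ (hd ▸ le_max_left _ _) (hd ▸ le_max_right _ _) hd1 ha hb hab
    hazero hatop hbzero hbtop hsharea hshareb
end
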